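/- arXiv:1509.04977 — 2 statements merged into one kernel-verified Lean document; each statement's English description precedes it below -/
import Mathlib

section
/- If n ≥ 4, then the n-th symbolic power I^{(n)} of the Fermat ideal has no homogeneous reduction with two generators: there exist no homogeneous polynomials σ, τ ∈ R and no integer k ≥ 0 such that the ideal (σ, τ) is contained in I^{(n)} and (I^{(n)})^{k+1} = (σ, τ)·(I^{(n)})^{k}. -/
open MvPolynomial

noncomputable section

/-- `f = yⁿ − zⁿ` in `K[x,y,z]` (variables `x = X 0`, `y = X 1`, `z = X 2`). -/
def pf (K : Type*) [Field K] (n : ℕ) : MvPolynomial (Fin 3) K := X 1 ^ n - X 2 ^ n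

/-- `g = zⁿ − xⁿ`. -/
def pg (K : Type*) [Field K] (n : ℕ) : MvPolynomial (Fin 3) K := X 2 ^ n - X 0 ^ n

/-- `h = xⁿ − yⁿ`. -/
def ph (K : Type*) [Field K] (n : ℕ) : MvPolynomial (Fin 3) K := X 0 ^ n - X 1 ^ n

/-- The ideal `(f, g)`. -/
def Ifg (K : Type*) [Field K] (n : ℕ) : Ideal (MvPolynomial (Fin 3) K) :=
  Ideal.span {pf K n, pg K n}

/-- The ideal `(x, y)`. -/
def Ixy (K : Type*) [Field K] : Ideal (MvPolynomial (Fin 3) K) := Ideal.span {X 0, X 1}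

/-- The ideal `(y, z)`. -/
def Iyz (K : Type*) [Field K] : Ideal (MvPolynomial (Fin 3) K) := Ideal.span {X 1, X 2}

/-- The ideal `(z, x)`. -/
def Izx (K : Type*) [Field K] : Ideal (MvPolynomial (Fin 3) K) := Ideal.span {X 2, X 0}

/-- The `m`-th symbolic power of the Fermat ideal `I = (xf, yg, zh)`:
`I^{(m)} = (f,g)^m ∩ (x,y)^m ∩ (y,z)^m ∩ (z,x)^m`. -/
def symbPow (K : Type*) [Field K] (n m : ℕ) : Ideal (MvPolynomial (Fin 3) K) :=
  Ifg K n ^ m ⊓ Ixy K ^ m ⊓ Iyz K ^ m ⊓ Izx K ^ m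

section Auxiliary

variable {K : Type*} [Field K]

/-- If `(σ, τ)` is a reduction of `J`, then large powers of `J` lie in `(σ) + (τ ^ m)`. -/
lemma pow_le_span_sup_span_pow {R : Type*} [CommRing R] {J : Ideal R} {σ τ : R} {k : ℕ}
    (h : J ^ (k + 1) = Ideal.span {σ, τ} * J ^ k) (m : ℕ) :
    J ^ (1 + m + k) ≤ Ideal.span {σ} ⊔ Ideal.span {τ ^ m} := by
  have key : ∀ m : ℕ, J ^ (m + k) = Ideal.span {σ, τ} ^ m * J ^ k := by
    intro m
    induction m with
    | zero => simp
    | succ m ih =>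
      rw [show m + 1 + k = (m + k) + 1 by ring, pow_succ, ih, mul_assoc, ← pow_succ, h, pow_succ,
        mul_assoc]
  rw [key, Ideal.span_insert]
  refine Ideal.mul_le_left.trans (Ideal.sup_pow_add_le_pow_sup_pow.trans ?_)
  rw [pow_one, Ideal.span_singleton_pow]

lemma homogeneousComponent_mul_of_isHomogeneous {ι R : Type*} [CommRing R]
    {b : MvPolynomial ι R} {d : ℕ} (a : MvPolynomial ι R) (hb : b.IsHomogeneous d) (N : ℕ) :
    homogeneousComponent N (a * b) = if d ≤ N then homogeneousComponent (N - d) a * b else 0 := by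
  let _ := MvPolynomial.gradedAlgebra (σ := ι) (R := R)
  have := DirectSum.coe_decompose_mul_of_right_mem (homogeneousSubmodule ι R) (a := a) N
    ((mem_homogeneousSubmodule d b).2 hb)
  have e : ∀ (p : MvPolynomial ι R) (i : ℕ),
      (DirectSum.decompose (homogeneousSubmodule ι R) p i : MvPolynomial ι R) =
        homogeneousComponent i p := fun p i => decomposition.decompose'_apply p i
  rwa [e, e] at this

/-- A form of degree less than `deg τ` that is integral over `(σ, τ)` is nilpotent modulo `σ`. -/
lemma exists_dvd_pow_of_reduction {ι R : Type*} [CommRing R] {J : Ideal (MvPolynomial ι R)}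
    {σ τ F : MvPolynomial ι R} {k d e : ℕ} (hτ : τ.IsHomogeneous d) (hσ : ∃ c, σ.IsHomogeneous c)
    (h : J ^ (k + 1) = Ideal.span {σ, τ} * J ^ k) (hF : F ∈ J) (hFe : F.IsHomogeneous e)
    (hed : e < d) : ∃ M, σ ∣ F ^ M := by
  obtain ⟨c, hσ⟩ := hσ
  set m := e * (k + 1) + 1
  refine ⟨1 + m + k, ?_⟩
  have hmem := pow_le_span_sup_span_pow h m (Ideal.pow_mem_pow hF (1 + m + k))
  obtain ⟨_, ha, _, hb, hab⟩ := Submodule.mem_sup.1 hmem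
  obtain ⟨a, rfl⟩ := Ideal.mem_span_singleton'.1 ha
  obtain ⟨b, rfl⟩ := Ideal.mem_span_singleton'.1 hb
  have hlt : ¬ d * m ≤ e * (1 + m + k) := by
    have : (e + 1) * m ≤ d * m := Nat.mul_le_mul_right _ hed
    have : (e + 1) * m = e * (1 + m + k) + 1 := by simp only [m]; ring
    omega
  have := congrArg (homogeneousComponent (e * (1 + m + k))) hab
  rw [map_add, homogeneousComponent_mul_of_isHomogeneous _ hσ,
    homogeneousComponent_mul_of_isHomogeneous _ (hτ.pow m), if_neg hlt, add_zero,
    homogeneousComponent_eq_self (hFe.pow _)] at this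
  rw [← this]
  split_ifs
  · exact dvd_mul_left _ _
  · exact dvd_zero _

/-- Expansion around the coordinate point where `X i` and `X j` vanish: these two variables are
scaled by a parameter and the remaining one is set to `1`. -/
def expandAt (K : Type*) [Field K] (i j : Fin 3) :
    MvPolynomial (Fin 3) K →ₐ[K] Polynomial (MvPolynomial (Fin 3) K) :=
  aeval fun m => if m = i ∨ m = j then Polynomial.C (X m) * Polynomial.X else 1

/-- The coordinate point where `X i` and `X j` vanish. -/
def coordPoint (K : Type*) [Field K] (i j : Fin 3) : Fin 3 → K :=
  fun m => if m = i ∨ m = j then 0 else 1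

lemma X_pow_dvd_expandAt {i j : Fin 3} {m : ℕ} {p : MvPolynomial (Fin 3) K}
    (hp : p ∈ Ideal.span {X i, X j} ^ m) : Polynomial.X ^ m ∣ expandAt K i j p := by
  have h := Ideal.mem_map_of_mem (expandAt K i j) hp
  rw [Ideal.map_pow, Ideal.map_span, Set.image_pair] at h
  rw [← Ideal.mem_span_singleton, ← Ideal.span_singleton_pow]
  refine Ideal.pow_right_mono (Ideal.span_le.2 ?_) m h
  rintro _ (rfl | rfl) <;> simp [expandAt, Ideal.mem_span_singleton]

lemma coeff_zero_expandAt (i j : Fin 3) (p : MvPolynomial (Fin 3) K) :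
    (expandAt K i j p).coeff 0 = C (eval (coordPoint K i j) p) := by
  have : ((Polynomial.constantCoeff (R := MvPolynomial (Fin 3) K)).comp
      (expandAt K i j).toRingHom) = C.comp (eval (coordPoint K i j)) := by
    refine MvPolynomial.ringHom_ext (fun r => ?_) (fun m => ?_)
    · simp [expandAt]
    · by_cases hm : m = i ∨ m = j <;> simp [expandAt, coordPoint, hm]
  exact congrArg (fun φ => φ p) this

lemma map_eval_expandAt (i j : Fin 3) (p : MvPolynomial (Fin 3) K) :
    (expandAt K i j p).map (eval (coordPoint K i j)) =
      Polynomial.C (eval (coordPoint K i j) p) := by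
  have : ((Polynomial.mapRingHom (eval (coordPoint K i j))).comp
      (expandAt K i j).toRingHom) = Polynomial.C.comp (eval (coordPoint K i j)) := by
    refine MvPolynomial.ringHom_ext (fun r => ?_) (fun m => ?_)
    · simp [expandAt]
    · by_cases hm : m = i ∨ m = j <;> simp [expandAt, coordPoint, hm]
  exact congrArg (fun φ => φ p) this

lemma natDegree_expandAt_le (i j : Fin 3) (p : MvPolynomial (Fin 3) K) :
    (expandAt K i j p).natDegree ≤ p.totalDegree := by
  have h := aeval_natDegree_le (n := 1) (map (C (σ := Fin 3)) p)
    (Finset.sup_mono (support_map_subset _ _))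
    (fun m => if m = i ∨ m = j then Polynomial.C (X m) * Polynomial.X else 1) (by
      intro m
      split_ifs
      · exact (Polynomial.natDegree_C_mul_le _ _).trans Polynomial.natDegree_X_le
      · simp)
  rw [mul_one, aeval_def, eval₂_map] at h
  exact h

/-- If `(σ, τ)` is a reduction of `J` and `J` has order exactly `n` at a coordinate point, with
leading forms without common factor, then `σ` has order at most `n` there. -/
lemma not_X_pow_dvd_expandAt_of_reduction {n k : ℕ} {i j : Fin 3} (hij : i ≠ j) (hn : n ≠ 0)
    {J : Ideal (MvPolynomial (Fin 3) K)} {σ τ F G : MvPolynomial (Fin 3) K}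
    (hJ : J ≤ Ideal.span {X i, X j} ^ n) (hτ : τ ∈ J)
    (h : J ^ (k + 1) = Ideal.span {σ, τ} * J ^ k)
    (hF : (X i * F) ^ n ∈ J) (hG : (X j * G) ^ n ∈ J)
    (hF0 : eval (coordPoint K i j) F ≠ 0) (hG0 : eval (coordPoint K i j) G ≠ 0) :
    ¬ Polynomial.X ^ (n + 1) ∣ expandAt K i j σ := by
  rintro ⟨s, hs⟩
  obtain ⟨t, ht⟩ := X_pow_dvd_expandAt (hJ hτ)
  have key : ∀ l : Fin 3, (l = i ∨ l = j) → ∀ H : MvPolynomial (Fin 3) K, (X l * H) ^ n ∈ J →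
      eval (coordPoint K i j) H ≠ 0 → t.coeff 0 ∣ X l ^ (n * (k + 1)) := by
    intro l hl H hH hH0
    have hmem : ((X l * H) ^ n) ^ (k + 1) ∈ Ideal.span {σ, τ} * J ^ k :=
      h ▸ Ideal.pow_mem_pow hH _
    rw [Ideal.span_insert, Ideal.sup_mul] at hmem
    obtain ⟨_, ha, _, hb, hab⟩ := Submodule.mem_sup.1 hmem
    obtain ⟨a, haJ, rfl⟩ := Ideal.mem_span_singleton_mul.1 ha
    obtain ⟨b, hbJ, rfl⟩ := Ideal.mem_span_singleton_mul.1 hb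
    have hle : J ^ k ≤ Ideal.span {X i, X j} ^ (n * k) := by
      rw [pow_mul]; exact Ideal.pow_right_mono hJ k
    obtain ⟨a', ha'⟩ := X_pow_dvd_expandAt (hle haJ)
    obtain ⟨b', hb'⟩ := X_pow_dvd_expandAt (hle hbJ)
    have e := congrArg (expandAt K i j) hab
    have hX : expandAt K i j (X l) = Polynomial.C (X l) * Polynomial.X := by
      simp [expandAt, hl]
    simp only [map_add, map_mul, map_pow, hs, ht, ha', hb', hX] at e
    have e2 : (Polynomial.X : Polynomial (MvPolynomial (Fin 3) K)) ^ (n * (k + 1)) *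
        (Polynomial.X * (s * a') + t * b') = Polynomial.X ^ (n * (k + 1)) *
        (Polynomial.C (X l) * expandAt K i j H) ^ (n * (k + 1)) := by
      calc _ = _ := by ring
        _ = _ := e
        _ = _ := by ring
    have e3 := mul_left_cancel₀ (pow_ne_zero _ Polynomial.X_ne_zero) e2
    have e4 := congrArg Polynomial.constantCoeff e3
    simp only [map_add, map_mul, map_pow, Polynomial.constantCoeff_apply, Polynomial.coeff_X_zero,
      zero_mul, zero_add, Polynomial.coeff_C_zero, coeff_zero_expandAt, mul_pow] at e4
    have hu : IsUnit (C (eval (coordPoint K i j) H) ^ (n * (k + 1)) : MvPolynomial (Fin 3) K) :=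
      ((isUnit_iff_ne_zero.2 hH0).map C).pow _
    exact hu.dvd_mul_right.1 ⟨_, e4.symm⟩
  have hi := key i (.inl rfl) F hF hF0
  have hj := key j (.inr rfl) G hG hG0
  obtain ⟨r, -, hr⟩ := (dvd_prime_pow (X_prime (i := i) (R := K)) _).1 hi
  have hunit : IsUnit (t.coeff 0) := by
    rcases Nat.eq_zero_or_pos r with rfl | hr0
    · rw [pow_zero] at hr
      exact hr.isUnit_iff.2 isUnit_one
    · exfalso
      have h1 : (X i : MvPolynomial (Fin 3) K) ∣ t.coeff 0 :=
        (dvd_pow_self _ hr0.ne').trans hr.symm.dvd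
      have h2 := (X_prime (i := i) (R := K)).dvd_of_dvd_pow (h1.trans hj)
      exact hij (X_dvd_X.1 h2)
  have hz : eval (coordPoint K i j) (t.coeff 0) = 0 := by
    have e := congrArg (Polynomial.map (eval (coordPoint K i j))) ht
    rw [map_eval_expandAt, Polynomial.map_mul, Polynomial.map_pow, Polynomial.map_X] at e
    have e1 := congrArg (fun q => Polynomial.coeff q n) e
    rw [Polynomial.coeff_C_of_ne_zero hn] at e1
    simpa [Polynomial.coeff_X_pow_mul'] using e1.symm
  exact (hunit.map (eval (coordPoint K i j))).ne_zero hz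

/-- A divisor `A` of a power of a form `f` in `X i`, `X j` only has order `deg A` at the
coordinate point where these variables vanish. -/
lemma X_pow_totalDegree_dvd_expandAt {i j : Fin 3} {n N : ℕ} {A f : MvPolynomial (Fin 3) K}
    (hf : f.IsHomogeneous n) (hf0 : f ≠ 0)
    (hfe : expandAt K i j f = Polynomial.C f * Polynomial.X ^ n) (hA : A ∣ f ^ N) :
    Polynomial.X ^ A.totalDegree ∣ expandAt K i j A := by
  obtain ⟨B, hB⟩ := hA
  have hAB : A * B ≠ 0 := hB ▸ pow_ne_zero _ hf0
  have hA0 := left_ne_zero_of_mul hAB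
  have hB0 := right_ne_zero_of_mul hAB
  have hdeg : A.totalDegree + B.totalDegree = n * N := by
    rw [← totalDegree_mul_of_isDomain hA0 hB0, ← hB, (hf.pow N).totalDegree (pow_ne_zero _ hf0)]
  have he : expandAt K i j A * expandAt K i j B =
      Polynomial.C (f ^ N) * Polynomial.X ^ (n * N) := by
    rw [← map_mul, ← hB, map_pow, hfe, mul_pow, ← pow_mul, map_pow]
  have he0 : expandAt K i j A * expandAt K i j B ≠ 0 := by
    rw [he]
    exact mul_ne_zero (Polynomial.C_ne_zero.2 (pow_ne_zero _ hf0))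
      (pow_ne_zero _ Polynomial.X_ne_zero)
  have ht := Polynomial.natTrailingDegree_mul (left_ne_zero_of_mul he0) (right_ne_zero_of_mul he0)
  rw [he, Polynomial.C_mul_X_pow_eq_monomial,
    Polynomial.natTrailingDegree_monomial (pow_ne_zero _ hf0)] at ht
  have h1 := (Polynomial.natTrailingDegree_le_natDegree _).trans (natDegree_expandAt_le i j A)
  have h2 := (Polynomial.natTrailingDegree_le_natDegree _).trans (natDegree_expandAt_le i j B)
  rw [Polynomial.X_pow_dvd_iff]
  intro d hd
  exact Polynomial.coeff_eq_zero_of_lt_natTrailingDegree (by omega)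

lemma isHomogeneous_X_pow_sub_X_pow (i j : Fin 3) (n : ℕ) :
    (X i ^ n - X j ^ n : MvPolynomial (Fin 3) K).IsHomogeneous n :=
  (isHomogeneous_X_pow i n).sub (isHomogeneous_X_pow j n)

lemma X_pow_sub_X_pow_ne_zero {i j : Fin 3} (hij : i ≠ j) {n : ℕ} (hn : n ≠ 0) :
    (X i ^ n - X j ^ n : MvPolynomial (Fin 3) K) ≠ 0 := by
  intro h
  have := congrArg (eval (Pi.single i 1)) h
  simp [hij.symm, hn] at this

lemma expandAt_X_pow_sub_X_pow (i j : Fin 3) (n : ℕ) :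
    expandAt K i j (X i ^ n - X j ^ n) =
      Polynomial.C (X i ^ n - X j ^ n) * Polynomial.X ^ n := by
  simp [expandAt]
  ring

lemma ph_eq (n : ℕ) : ph K n = -(pf K n + pg K n) := by
  simp only [pf, pg, ph]; ring

lemma X_pow_sub_X_pow_mem_span_pow (i j : Fin 3) (n : ℕ) :
    (X i ^ n - X j ^ n : MvPolynomial (Fin 3) K) ∈ Ideal.span {X i, X j} ^ n :=
  sub_mem (Ideal.pow_mem_pow (Ideal.subset_span (by simp)) n)
    (Ideal.pow_mem_pow (Ideal.subset_span (by simp)) n)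

lemma pf_mem_Ifg (n : ℕ) : pf K n ∈ Ifg K n := Ideal.subset_span (by simp)

lemma pg_mem_Ifg (n : ℕ) : pg K n ∈ Ifg K n := Ideal.subset_span (by simp)

lemma ph_mem_Ifg (n : ℕ) : ph K n ∈ Ifg K n := by
  rw [ph_eq]
  exact neg_mem (add_mem (pf_mem_Ifg n) (pg_mem_Ifg n))

lemma pf_mem_Iyz (n : ℕ) : pf K n ∈ Iyz K ^ n := X_pow_sub_X_pow_mem_span_pow 1 2 n

lemma pg_mem_Izx (n : ℕ) : pg K n ∈ Izx K ^ n := X_pow_sub_X_pow_mem_span_pow 2 0 n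

lemma ph_mem_Ixy (n : ℕ) : ph K n ∈ Ixy K ^ n := X_pow_sub_X_pow_mem_span_pow 0 1 n

lemma X_mul_pf_pow_mem_symbPow {n : ℕ} (hn : n ≠ 0) : (X 0 * pf K n) ^ n ∈ symbPow K n n := by
  rw [mul_pow]
  refine ⟨⟨⟨?_, ?_⟩, ?_⟩, ?_⟩
  · exact Ideal.mul_mem_left _ _ (Ideal.pow_mem_pow (pf_mem_Ifg n) n)
  · exact Ideal.mul_mem_right _ _ (Ideal.pow_mem_pow (Ideal.subset_span (by simp)) n)
  · exact Ideal.mul_mem_left _ _ (Ideal.pow_mem_of_mem _ (pf_mem_Iyz n) n (by omega))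
  · exact Ideal.mul_mem_right _ _ (Ideal.pow_mem_pow (Ideal.subset_span (by simp)) n)

lemma X_mul_pg_pow_mem_symbPow {n : ℕ} (hn : n ≠ 0) : (X 1 * pg K n) ^ n ∈ symbPow K n n := by
  rw [mul_pow]
  refine ⟨⟨⟨?_, ?_⟩, ?_⟩, ?_⟩
  · exact Ideal.mul_mem_left _ _ (Ideal.pow_mem_pow (pg_mem_Ifg n) n)
  · exact Ideal.mul_mem_right _ _ (Ideal.pow_mem_pow (Ideal.subset_span (by simp)) n)
  · exact Ideal.mul_mem_right _ _ (Ideal.pow_mem_pow (Ideal.subset_span (by simp)) n)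
  · exact Ideal.mul_mem_left _ _ (Ideal.pow_mem_of_mem _ (pg_mem_Izx n) n (by omega))

lemma X_mul_ph_pow_mem_symbPow {n : ℕ} (hn : n ≠ 0) : (X 2 * ph K n) ^ n ∈ symbPow K n n := by
  rw [mul_pow]
  refine ⟨⟨⟨?_, ?_⟩, ?_⟩, ?_⟩
  · exact Ideal.mul_mem_left _ _ (Ideal.pow_mem_pow (ph_mem_Ifg n) n)
  · exact Ideal.mul_mem_left _ _ (Ideal.pow_mem_of_mem _ (ph_mem_Ixy n) n (by omega))
  · exact Ideal.mul_mem_right _ _ (Ideal.pow_mem_pow (Ideal.subset_span (by simp)) n)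
  · exact Ideal.mul_mem_right _ _ (Ideal.pow_mem_pow (Ideal.subset_span (by simp)) n)

lemma pf_pow_mul_pg_mul_ph_mem_symbPow (m : ℕ) (hm : m ≠ 0) :
    pf K (m + 2) ^ m * pg K (m + 2) * ph K (m + 2) ∈ symbPow K (m + 2) (m + 2) := by
  refine ⟨⟨⟨?_, ?_⟩, ?_⟩, ?_⟩
  · rw [SetLike.mem_coe, pow_add, pow_two, ← mul_assoc]
    exact Ideal.mul_mem_mul (Ideal.mul_mem_mul (Ideal.pow_mem_pow (pf_mem_Ifg _) m)
      (pg_mem_Ifg _)) (ph_mem_Ifg _)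
  · exact Ideal.mul_mem_left _ _ (ph_mem_Ixy _)
  · rw [mul_assoc]
    exact Ideal.mul_mem_right _ _ (Ideal.pow_mem_of_mem _ (pf_mem_Iyz _) m (by omega))
  · exact Ideal.mul_mem_right _ _ (Ideal.mul_mem_left _ _ (pg_mem_Izx _))

/-- Nonzero forms in the symbolic power have degree at least `n ^ 2`. -/
lemma sq_le_of_mem_symbPow {n d : ℕ} {σ : MvPolynomial (Fin 3) K} (hσ : σ.IsHomogeneous d)
    (hσ0 : σ ≠ 0) (hmem : σ ∈ symbPow K n n) : n * n ≤ d := by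
  have hX : ∀ i : Fin 3, (X i ^ n : MvPolynomial (Fin 3) K) ∈ idealOfVars (Fin 3) K ^ n :=
    fun i => Ideal.pow_mem_pow (Ideal.subset_span (Set.mem_range_self i)) n
  have hle : Ifg K n ≤ idealOfVars (Fin 3) K ^ n := by
    refine Ideal.span_le.2 ?_
    rintro _ (rfl | rfl)
    · exact sub_mem (hX _) (hX _)
    · exact sub_mem (hX _) (hX _)
  have h1 : σ ∈ idealOfVars (Fin 3) K ^ (n * n) := by
    rw [pow_mul]
    exact Ideal.pow_right_mono hle n hmem.1.1.1
  rw [mem_pow_idealOfVars_iff] at h1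
  obtain ⟨s, hs⟩ := exists_coeff_ne_zero hσ0
  have h2 := h1 s (mem_support_iff.2 hs)
  by_contra hlt
  exact hs (hσ.coeff_eq_zero (by omega))

/-- Restriction to the line `x = y`. -/
def restrictLine (K : Type*) [Field K] : MvPolynomial (Fin 3) K →ₐ[K] MvPolynomial (Fin 3) K :=
  aeval ![X 1, X 1, X 2]

lemma restrictLine_pf (n : ℕ) : restrictLine K (pf K n) = pf K n := by
  simp [restrictLine, pf]

/-- Forms of small degree in the symbolic power vanish on the line `x = y`. -/
lemma restrictLine_eq_zero {n d : ℕ} (hn : n ≠ 0) {σ : MvPolynomial (Fin 3) K}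
    (hσ : σ.IsHomogeneous d) (hmem : σ ∈ symbPow K n n) (hd : d < n * n + n) :
    restrictLine K σ = 0 := by
  by_contra hne
  have hf : (pf K n).IsHomogeneous n := isHomogeneous_X_pow_sub_X_pow 1 2 n
  have hf0 : pf K n ≠ 0 := X_pow_sub_X_pow_ne_zero (by decide) hn
  have h1 : pf K n ^ n ∣ restrictLine K σ := by
    have h := Ideal.mem_map_of_mem (restrictLine K) hmem.1.1.1
    rw [Ideal.map_pow, Ifg, Ideal.map_span, Set.image_pair] at h
    rw [← Ideal.mem_span_singleton, ← Ideal.span_singleton_pow]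
    refine Ideal.pow_right_mono (Ideal.span_le.2 ?_) n h
    rintro _ (rfl | rfl)
    · simp [restrictLine_pf]
    · rw [SetLike.mem_coe, Ideal.mem_span_singleton]
      exact ⟨-1, by simp [restrictLine, pf, pg]⟩
  have h2 : X 1 ^ n ∣ restrictLine K σ := by
    have h := Ideal.mem_map_of_mem (restrictLine K) hmem.1.1.2
    rw [Ideal.map_pow, Ixy, Ideal.map_span, Set.image_pair] at h
    rw [← Ideal.mem_span_singleton, ← Ideal.span_singleton_pow]
    refine Ideal.pow_right_mono (Ideal.span_le.2 ?_) n h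
    rintro _ (rfl | rfl) <;> simp [restrictLine]
  obtain ⟨c, hc⟩ := h1
  have hX : ¬ (X 1 : MvPolynomial (Fin 3) K) ∣ pf K n ^ n := by
    intro h
    obtain ⟨q, hq⟩ := (X_prime (R := K)).dvd_of_dvd_pow h
    have := congrArg (eval (Pi.single 2 1)) hq
    simp [pf, hn] at this
  obtain ⟨e, rfl⟩ := (X_prime (R := K)).pow_dvd_of_dvd_mul_left n hX (hc ▸ h2)
  have hhom : (restrictLine K σ).IsHomogeneous (1 * d) := hσ.aeval _ (by
    intro i
    fin_cases i <;> exact isHomogeneous_X _ _)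
  have hdeg := hhom.totalDegree hne
  rw [hc] at hne hdeg
  have hr := right_ne_zero_of_mul hne
  rw [totalDegree_mul_of_isDomain (left_ne_zero_of_mul hne) hr,
    totalDegree_mul_of_isDomain (left_ne_zero_of_mul hr) (right_ne_zero_of_mul hr),
    (hf.pow n).totalDegree (pow_ne_zero _ hf0),
    totalDegree_X_pow] at hdeg
  omega

/-- One of the generators of a homogeneous reduction has degree at least `n ^ 2 + n`. -/
lemma degree_le_of_reduction {n k a b : ℕ} (hn : n ≠ 0) {σ τ : MvPolynomial (Fin 3) K}
    (hσ : σ.IsHomogeneous a) (hτ : τ.IsHomogeneous b) (hσJ : σ ∈ symbPow K n n)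
    (hτJ : τ ∈ symbPow K n n)
    (h : symbPow K n n ^ (k + 1) = Ideal.span {σ, τ} * symbPow K n n ^ k) :
    n * n + n ≤ a ∨ n * n + n ≤ b := by
  by_contra! hlt
  have h1 := restrictLine_eq_zero hn hσ hσJ hlt.1
  have h2 := restrictLine_eq_zero hn hτ hτJ hlt.2
  have hmem : ((X 0 * pf K n) ^ n) ^ (k + 1) ∈ Ideal.span {σ, τ} :=
    Ideal.mul_le_left (I := Ideal.span {σ, τ}) (J := symbPow K n n ^ k)
      (h ▸ Ideal.pow_mem_pow (X_mul_pf_pow_mem_symbPow hn) (k + 1))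
  have hle : Ideal.span {σ, τ} ≤ RingHom.ker (restrictLine K) := by
    refine Ideal.span_le.2 ?_
    rintro _ (rfl | rfl)
    · exact h1
    · exact h2
  have h0 : restrictLine K (((X 0 * pf K n) ^ n) ^ (k + 1)) = 0 := hle hmem
  rw [map_pow, map_pow, map_mul, restrictLine_pf] at h0
  have hf0 : pf K n ≠ 0 := X_pow_sub_X_pow_ne_zero (by decide) hn
  have hX0 : restrictLine K (X 0) ≠ 0 := by simp [restrictLine]
  exact pow_ne_zero _ (pow_ne_zero _ (mul_ne_zero hX0 hf0)) h0

lemma false_of_reduction_of_sq_lt {n k a b : ℕ} (hn : 4 ≤ n) {σ τ : MvPolynomial (Fin 3) K}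
    (hσ : σ.IsHomogeneous a) (hτ : τ.IsHomogeneous b) (hσJ : σ ∈ symbPow K n n)
    (hτJ : τ ∈ symbPow K n n)
    (h : symbPow K n n ^ (k + 1) = Ideal.span {σ, τ} * symbPow K n n ^ k)
    (hb : n * n < b) : False := by
  have hn0 : n ≠ 0 := by omega
  have hf : (pf K n).IsHomogeneous n := isHomogeneous_X_pow_sub_X_pow 1 2 n
  have hg : (pg K n).IsHomogeneous n := isHomogeneous_X_pow_sub_X_pow 2 0 n
  have hh : (ph K n).IsHomogeneous n := isHomogeneous_X_pow_sub_X_pow 0 1 n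
  have hf0 : pf K n ≠ 0 := X_pow_sub_X_pow_ne_zero (by decide) hn0
  have hg0 : pg K n ≠ 0 := X_pow_sub_X_pow_ne_zero (by decide) hn0
  have hh0 : ph K n ≠ 0 := X_pow_sub_X_pow_ne_zero (by decide) hn0
  obtain ⟨M, hM⟩ : ∃ M, σ ∣ (pf K n ^ (n - 2) * pg K n * ph K n) ^ M := by
    refine exists_dvd_pow_of_reduction hτ ⟨a, hσ⟩ h ?_ (((hf.pow _).mul hg).mul hh) ?_
    · obtain ⟨m, rfl⟩ : ∃ m, n = m + 2 := ⟨n - 2, by omega⟩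
      exact pf_pow_mul_pg_mul_ph_mem_symbPow m (by omega)
    · obtain ⟨m, rfl⟩ : ∃ m, n = m + 2 := ⟨n - 2, by omega⟩
      calc _ = (m + 2) * (m + 2) := by rw [Nat.add_sub_cancel]; ring
        _ < b := hb
  rw [mul_pow, mul_pow, ← pow_mul] at hM
  have hσ0 : σ ≠ 0 := by
    rintro rfl
    exact mul_ne_zero (mul_ne_zero (pow_ne_zero _ hf0) (pow_ne_zero _ hg0)) (pow_ne_zero _ hh0)
      (zero_dvd_iff.1 hM)
  have hsq := sq_le_of_mem_symbPow hσ hσ0 hσJ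
  obtain ⟨AB, D, hAB, hD, rfl⟩ := exists_dvd_and_dvd_of_dvd_mul hM
  obtain ⟨A, B, hA, hB, rfl⟩ := exists_dvd_and_dvd_of_dvd_mul hAB
  have hAB0 := left_ne_zero_of_mul hσ0
  have hdeg := hσ.totalDegree hσ0
  rw [totalDegree_mul_of_isDomain hAB0 (right_ne_zero_of_mul hσ0),
    totalDegree_mul_of_isDomain (left_ne_zero_of_mul hAB0) (right_ne_zero_of_mul hAB0)] at hdeg
  have hA' : A.totalDegree ≤ n := by
    by_contra hlt
    refine not_X_pow_dvd_expandAt_of_reduction (i := 1) (j := 2) (by decide) hn0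
      (inf_le_left.trans inf_le_right) hτJ h (X_mul_pg_pow_mem_symbPow hn0) (X_mul_ph_pow_mem_symbPow hn0)
      (by simp [pg, coordPoint, hn0]) (by simp [ph, coordPoint, hn0]) ?_
    rw [map_mul, map_mul]
    exact (((pow_dvd_pow _ (by omega)).trans
      (X_pow_totalDegree_dvd_expandAt hf hf0 (expandAt_X_pow_sub_X_pow 1 2 n) hA)).mul_right
        _).mul_right _
  have hB' : B.totalDegree ≤ n := by
    by_contra hlt
    refine not_X_pow_dvd_expandAt_of_reduction (i := 2) (j := 0) (by decide) hn0
      inf_le_right hτJ h (X_mul_ph_pow_mem_symbPow hn0) (X_mul_pf_pow_mem_symbPow hn0)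
      (by simp [ph, coordPoint, hn0]) (by simp [pf, coordPoint, hn0]) ?_
    rw [map_mul, map_mul]
    exact (((pow_dvd_pow _ (by omega)).trans
      (X_pow_totalDegree_dvd_expandAt hg hg0 (expandAt_X_pow_sub_X_pow 2 0 n) hB)).mul_left
        _).mul_right _
  have hD' : D.totalDegree ≤ n := by
    by_contra hlt
    refine not_X_pow_dvd_expandAt_of_reduction (i := 0) (j := 1) (by decide) hn0
      (inf_le_left.trans (inf_le_left.trans inf_le_right)) hτJ h (X_mul_pf_pow_mem_symbPow hn0) (X_mul_pg_pow_mem_symbPow hn0)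
      (by simp [pf, coordPoint, hn0]) (by simp [pg, coordPoint, hn0]) ?_
    rw [map_mul]
    exact ((pow_dvd_pow _ (by omega)).trans
      (X_pow_totalDegree_dvd_expandAt hh hh0 (expandAt_X_pow_sub_X_pow 0 1 n) hD)).mul_left _
  have : 4 * n ≤ n * n := Nat.mul_le_mul_right n hn
  omega

end Auxiliary

/-- for `n ≥ 4`, the `n`-th symbolic power `I^{(n)}` of the Fermat ideal has
no homogeneous reduction with two generators: there are no homogeneous `σ, τ` and no
`k ≥ 0` with `(σ,τ) ⊆ I^{(n)}` and `(I^{(n)})^{k+1} = (σ,τ)·(I^{(n)})^k`. -/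
theorem fermat_no_two_generated_reduction {K : Type*} [Field K] (n : ℕ) (hn : 4 ≤ n)
    (hζ : ∃ ζ : K, IsPrimitiveRoot ζ n) (hinv : IsUnit (n : K)) :
    ¬ ∃ (σ τ : MvPolynomial (Fin 3) K) (dσ dτ : ℕ) (k : ℕ),
        σ.IsHomogeneous dσ ∧ τ.IsHomogeneous dτ ∧
        Ideal.span {σ, τ} ≤ symbPow K n n ∧
        (symbPow K n n) ^ (k + 1) = Ideal.span {σ, τ} * (symbPow K n n) ^ k := by
  rintro ⟨σ, τ, a, b, k, hσ, hτ, hle, h⟩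
  have hσJ : σ ∈ symbPow K n n := hle (Ideal.subset_span (by simp))
  have hτJ : τ ∈ symbPow K n n := hle (Ideal.subset_span (by simp))
  rcases degree_le_of_reduction (by omega) hσ hτ hσJ hτJ h with ha | hb
  · rw [Set.pair_comm] at h
    exact false_of_reduction_of_sq_lt hn hτ hσ hτJ hσJ h (by omega)
  · exact false_of_reduction_of_sq_lt hn hσ hτ hσJ hτJ h (by omega)
end
end

section
/- For every integer n ≥ 3, the ideal J = (f^{n−2}gh, f g^{n−2}h, g^{n−2}f^{2}x^{n} + h^{n−2}g^{2}y^{n} + f^{n−2}h^{2}z^{n}) of R = K[x,y,z] satisfies J · I^{(n)} = I^{(2n)}. Since I^{(2n)} = (I^{(n)})^{2}, J is a reduction of I^{(n)} with reduction number one: (I^{(n)})^{2} = J·I^{(n)}. -/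
open MvPolynomial

noncomputable section

/-- The numerical conditions for `xⁱyʲzᵏfᵖg^qhʳ` to lie in the `m`-th symbolic power. -/
def FermatExps (n m i j k p q r : ℕ) : Prop :=
  m ≤ p + q + r ∧ m ≤ i + j + n * r ∧ m ≤ j + k + n * p ∧ m ≤ k + i + n * q

section Reduction

variable {S : Type*} [CommRing S] {n : ℕ} {x y z f g h : S} {Q : Ideal S}

/-- If `Q` contains the products of `fgh·fⁿ⁻³` and `fgh·gⁿ⁻³` with the generators of the `n`-th
symbolic power, it contains the generators of the `2n`-th symbolic power divisible by `fgh`. -/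
theorem mem_of_exps_pos (hn : 3 ≤ n) (hfgh : f + g + h = 0)
    (h₁ : ∀ i j k p q r, FermatExps n n i j k p q r →
      (f ^ (n - 2) * g * h) * (x ^ i * y ^ j * z ^ k * f ^ p * g ^ q * h ^ r) ∈ Q)
    (h₂ : ∀ i j k p q r, FermatExps n n i j k p q r →
      (f * g ^ (n - 2) * h) * (x ^ i * y ^ j * z ^ k * f ^ p * g ^ q * h ^ r) ∈ Q)
    (i j k : ℕ) (r p q : ℕ) (hp : 1 ≤ p) (hq : 1 ≤ q) (hr : 1 ≤ r)
    (he : FermatExps n (2 * n) i j k p q r) :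
    x ^ i * y ^ j * z ^ k * f ^ p * g ^ q * h ^ r ∈ Q := by
  induction r using Nat.strong_induction_on generalizing p q with
  | _ r ih =>
  obtain ⟨e₁, e₂, e₃, e₄⟩ := he
  by_cases c₁ : n - 1 ≤ p ∨ (p = n - 2 ∧ n ≤ j + k)
  · obtain ⟨p, rfl⟩ : ∃ p', p = p' + (n - 2) := ⟨p - (n - 2), by omega⟩
    obtain ⟨q, rfl⟩ : ∃ q', q = q' + 1 := ⟨q - 1, by omega⟩
    obtain ⟨r, rfl⟩ : ∃ r', r = r' + 1 := ⟨r - 1, by omega⟩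
    convert h₁ i j k p q r ⟨by omega, by linarith, ?_, by linarith⟩ using 1
    · ring
    · rcases c₁ with c | ⟨-, c⟩
      · nlinarith [show 1 ≤ p by omega]
      · exact c.trans (Nat.le_add_right _ _)
  by_cases c₂ : n - 1 ≤ q ∨ (q = n - 2 ∧ n ≤ k + i)
  · obtain ⟨p, rfl⟩ : ∃ p', p = p' + 1 := ⟨p - 1, by omega⟩
    obtain ⟨q, rfl⟩ : ∃ q', q = q' + (n - 2) := ⟨q - (n - 2), by omega⟩
    obtain ⟨r, rfl⟩ : ∃ r', r = r' + 1 := ⟨r - 1, by omega⟩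
    convert h₂ i j k p q r ⟨by omega, by linarith, by linarith, ?_⟩ using 1
    · ring
    · rcases c₂ with c | ⟨-, c⟩
      · nlinarith [show 1 ≤ q by omega]
      · exact c.trans (Nat.le_add_right _ _)
  obtain ⟨r, rfl⟩ : ∃ r', r = r' + 3 := ⟨r - 3, by omega⟩
  have m₁ := ih (r + 2) (by omega) (p + 1) q (by omega) (by omega) (by omega)
    ⟨by omega, by nlinarith, by linarith, by linarith⟩
  have m₂ := ih (r + 2) (by omega) p (q + 1) (by omega) (by omega) (by omega)
    ⟨by omega, by nlinarith, by linarith, by linarith⟩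
  convert Q.neg_mem (Q.add_mem m₁ m₂) using 1
  linear_combination (x ^ i * y ^ j * z ^ k * f ^ p * g ^ q * h ^ (r + 2)) * hfgh

variable (hn : 3 ≤ n) (hfgh : f + g + h = 0) (hf : f = y ^ n - z ^ n)
  (hpos : ∀ i j k p q r, 1 ≤ p → 1 ≤ q → 1 ≤ r → FermatExps n (2 * n) i j k p q r →
    x ^ i * y ^ j * z ^ k * f ^ p * g ^ q * h ^ r ∈ Q)
  (h₃ : ∀ i j k p q r, FermatExps n n i j k p q r →
    (g ^ (n - 2) * f ^ 2 * x ^ n + h ^ (n - 2) * g ^ 2 * y ^ n + f ^ (n - 2) * h ^ 2 * z ^ n) *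
      (x ^ i * y ^ j * z ^ k * f ^ p * g ^ q * h ^ r) ∈ Q)

include hn hfgh hpos h₃ in
theorem mem_of_le_exp_y (i j k q r : ℕ) (hj : n ≤ j) (hq : 2 ≤ q) (hr : 2 ≤ r)
    (he : FermatExps n (2 * n) i j k 0 q r) :
    x ^ i * y ^ j * z ^ k * g ^ q * h ^ r ∈ Q := by
  obtain ⟨j, rfl⟩ : ∃ j', j = j' + n := ⟨j - n, by omega⟩
  obtain ⟨e₁, e₂, e₃, e₄⟩ := he
  have direct : ∀ q r, 2 * n ≤ q + r → 3 ≤ q → n - 1 ≤ r →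
      x ^ i * y ^ (j + n) * z ^ k * g ^ q * h ^ r ∈ Q := by
    intro q r hs hq hr
    obtain ⟨q, rfl⟩ : ∃ q', q = q' + 3 := ⟨q - 3, by omega⟩
    obtain ⟨r, rfl⟩ : ∃ r', r = r' + (n - 2) + 1 := ⟨r - (n - 2) - 1, by omega⟩
    have m₀ := h₃ i j k 0 (q + 1) (r + 1)
      ⟨by omega, by nlinarith, by linarith, by nlinarith⟩
    have m₁ := hpos (i + n) j k 2 (n - 2 + q + 1) (r + 1) (by omega) (by omega) (by omega)
      ⟨by omega, by nlinarith, by linarith, by nlinarith [show 2 ≤ n - 2 + q + 1 by omega]⟩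
    have m₂ := hpos i j (k + n) (n - 2) (q + 1) (r + 3) (by omega) (by omega) (by omega)
      ⟨by omega, by nlinarith, by nlinarith, by nlinarith⟩
    convert Q.sub_mem (Q.sub_mem m₀ m₁) m₂ using 1
    ring
  have key : ∀ s q r, n ≤ r + s + 1 → 2 * n ≤ q + r → 3 ≤ q → 2 ≤ r →
      x ^ i * y ^ (j + n) * z ^ k * g ^ q * h ^ r ∈ Q := by
    intro s
    induction s with
    | zero => exact fun q r h₁ h₂ h₃ _ => direct q r h₂ h₃ (by omega)
    | succ s ih =>
      intro q r h₁ h₂ h₃ h₄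
      by_cases c : n - 1 ≤ r
      · exact direct q r h₂ h₃ c
      obtain ⟨q, rfl⟩ : ∃ q', q = q' + 3 := ⟨q - 3, by omega⟩
      have m₁ := hpos i (j + n) k 1 (q + 2) r (by omega) (by omega) (by omega)
        ⟨by omega, by nlinarith, by linarith, by nlinarith⟩
      have m₂ := ih (q + 2) (r + 1) (by omega) (by omega) (by omega) (by omega)
      convert Q.neg_mem (Q.add_mem m₁ m₂) using 1
      linear_combination (x ^ i * y ^ (j + n) * z ^ k * g ^ (q + 2) * h ^ r) * hfgh
  by_cases c : q = 2
  · subst c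
    obtain ⟨r, rfl⟩ : ∃ r', r = r' + 3 := ⟨r - 3, by omega⟩
    have m₁ := hpos i (j + n) k 1 2 (r + 2) (by omega) (by omega) (by omega)
      ⟨by omega, by nlinarith, by linarith, by nlinarith⟩
    have m₂ := direct 3 (r + 2) (by omega) (by omega) (by omega)
    convert Q.neg_mem (Q.add_mem m₁ m₂) using 1
    linear_combination (x ^ i * y ^ (j + n) * z ^ k * g ^ 2 * h ^ (r + 2)) * hfgh
  · exact key n q r (by omega) (by omega) (by omega) hr

include hn hfgh hpos h₃ hf in
theorem mem_of_exp_f_eq_zero (i j k q r : ℕ) (hq : 1 ≤ q) (hr : 1 ≤ r)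
    (he : FermatExps n (2 * n) i j k 0 q r) :
    x ^ i * y ^ j * z ^ k * g ^ q * h ^ r ∈ Q := by
  have two : ∀ q r, 2 ≤ q → 2 ≤ r → 2 * n ≤ q + r →
      x ^ i * y ^ j * z ^ k * g ^ q * h ^ r ∈ Q := by
    intro q r hq hr hs
    obtain ⟨e₁, e₂, e₃, e₄⟩ := he
    by_cases c : n ≤ j
    · exact mem_of_le_exp_y hn hfgh hpos h₃ i j k q r c hq hr
        ⟨by omega, by nlinarith, e₃, by nlinarith⟩
    · obtain ⟨k, rfl⟩ : ∃ k', k = k' + n := ⟨k - n, by omega⟩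
      have m₁ := mem_of_le_exp_y hn hfgh hpos h₃ i (j + n) k q r (by omega) hq hr
        ⟨by omega, by nlinarith, by linarith, by nlinarith⟩
      have m₂ := hpos i j k 1 q r (by omega) (by omega) (by omega)
        ⟨by omega, by nlinarith, by linarith, by nlinarith⟩
      convert Q.sub_mem m₁ m₂ using 1
      linear_combination (x ^ i * y ^ j * z ^ k * g ^ q * h ^ r) * hf
  obtain ⟨e₁, e₂, e₃, e₄⟩ := he
  by_cases cq : q = 1
  · subst cq
    obtain ⟨r, rfl⟩ : ∃ r', r = r' + 4 := ⟨r - 4, by omega⟩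
    have m₁ := hpos i j k 1 1 (r + 3) (by omega) (by omega) (by omega)
      ⟨by omega, by nlinarith, by linarith, by linarith⟩
    have m₂ := two 2 (r + 3) (by omega) (by omega) (by omega)
    convert Q.neg_mem (Q.add_mem m₁ m₂) using 1
    linear_combination (x ^ i * y ^ j * z ^ k * g * h ^ (r + 3)) * hfgh
  by_cases cr : r = 1
  · subst cr
    obtain ⟨q, rfl⟩ : ∃ q', q = q' + 4 := ⟨q - 4, by omega⟩
    have m₁ := hpos i j k 1 (q + 3) 1 (by omega) (by omega) (by omega)
      ⟨by omega, by linarith, by linarith, by nlinarith⟩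
    have m₂ := two (q + 3) 2 (by omega) (by omega) (by omega)
    convert Q.neg_mem (Q.add_mem m₁ m₂) using 1
    linear_combination (x ^ i * y ^ j * z ^ k * g ^ (q + 3) * h) * hfgh
  exact two q r (by omega) (by omega) (by omega)

theorem FermatExps.rotate {m i j k p q r : ℕ} (he : FermatExps n m i j k p q r) :
    FermatExps n m j k i q r p :=
  ⟨by linarith [he.1], he.2.2.1, he.2.2.2, he.2.1⟩

include hn hfgh hf hpos h₃ in
theorem mem_of_fermatExps (hg : g = z ^ n - x ^ n) (hh : h = x ^ n - y ^ n) (i j k p q r : ℕ)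
    (he : FermatExps n (2 * n) i j k p q r) :
    x ^ i * y ^ j * z ^ k * f ^ p * g ^ q * h ^ r ∈ Q := by
  have zf : ∀ i j k q r, 1 ≤ q → 1 ≤ r → FermatExps n (2 * n) i j k 0 q r →
      x ^ i * y ^ j * z ^ k * g ^ q * h ^ r ∈ Q :=
    mem_of_exp_f_eq_zero hn hfgh hf hpos h₃
  have zg : ∀ i j k p r, 1 ≤ p → 1 ≤ r → FermatExps n (2 * n) i j k p 0 r →
      x ^ i * y ^ j * z ^ k * f ^ p * h ^ r ∈ Q := by
    intro i j k p r hp hr he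
    convert mem_of_exp_f_eq_zero (x := y) (y := z) (z := x) (f := g) (g := h) (h := f) (Q := Q)
      hn (by rw [← hfgh]; ring) hg (fun i j k p q r hp hq hr he => ?_)
      (fun i j k p q r he => ?_) j k i r p hr hp he.rotate using 1
    · ring
    · convert hpos k i j r p q hr hp hq he.rotate.rotate using 1; ring
    · convert h₃ k i j r p q he.rotate.rotate using 1; ring
  have zh : ∀ i j k p q, 1 ≤ p → 1 ≤ q → FermatExps n (2 * n) i j k p q 0 →
      x ^ i * y ^ j * z ^ k * f ^ p * g ^ q ∈ Q := by
    intro i j k p q hp hq he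
    convert mem_of_exp_f_eq_zero (x := z) (y := x) (z := y) (f := h) (g := f) (h := g) (Q := Q)
      hn (by rw [← hfgh]; ring) hh (fun i j k p q r hp hq hr he => ?_)
      (fun i j k p q r he => ?_) k i j p q hp hq he.rotate.rotate using 1
    · ring
    · convert hpos j k i q r p hq hr hp he.rotate using 1; ring
    · convert h₃ j k i q r p he.rotate using 1; ring
  obtain ⟨e₁, e₂, e₃, e₄⟩ := he
  rcases p with _ | p <;> rcases q with _ | q <;> rcases r with _ | r
  · omega
  · obtain ⟨r, rfl⟩ : ∃ r', r = r' + 1 := ⟨r - 1, by omega⟩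
    have m₁ := zg i j k 1 (r + 1) (by omega) (by omega)
      ⟨by omega, by nlinarith, by linarith, by linarith⟩
    have m₂ := zf i j k 1 (r + 1) (by omega) (by omega)
      ⟨by omega, by nlinarith, by linarith, by linarith⟩
    convert Q.neg_mem (Q.add_mem m₁ m₂) using 1
    linear_combination (x ^ i * y ^ j * z ^ k * h ^ (r + 1)) * hfgh
  · obtain ⟨q, rfl⟩ : ∃ q', q = q' + 1 := ⟨q - 1, by omega⟩
    have m₁ := zh i j k 1 (q + 1) (by omega) (by omega)
      ⟨by omega, by linarith, by linarith, by nlinarith⟩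
    have m₂ := zf i j k (q + 1) 1 (by omega) (by omega)
      ⟨by omega, by linarith, by linarith, by nlinarith⟩
    convert Q.neg_mem (Q.add_mem m₁ m₂) using 1
    linear_combination (x ^ i * y ^ j * z ^ k * g ^ (q + 1)) * hfgh
  · simpa using zf i j k (q + 1) (r + 1) (by omega) (by omega) ⟨e₁, e₂, e₃, e₄⟩
  · obtain ⟨p, rfl⟩ : ∃ p', p = p' + 1 := ⟨p - 1, by omega⟩
    have m₁ := zh i j k (p + 1) 1 (by omega) (by omega)
      ⟨by omega, by linarith, by nlinarith, by linarith⟩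
    have m₂ := zg i j k (p + 1) 1 (by omega) (by omega)
      ⟨by omega, by linarith, by nlinarith, by linarith⟩
    convert Q.neg_mem (Q.add_mem m₁ m₂) using 1
    linear_combination (x ^ i * y ^ j * z ^ k * f ^ (p + 1)) * hfgh
  · simpa using zg i j k (p + 1) (r + 1) (by omega) (by omega) ⟨e₁, e₂, e₃, e₄⟩
  · simpa using zh i j k (p + 1) (q + 1) (by omega) (by omega) ⟨e₁, e₂, e₃, e₄⟩
  · exact hpos i j k _ _ _ (by omega) (by omega) (by omega) ⟨e₁, e₂, e₃, e₄⟩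

end Reduction

/-- The product `xⁱyʲzᵏfᵖg^qhʳ`. -/
def fermatMonomial (K : Type*) [Field K] (n i j k p q r : ℕ) : MvPolynomial (Fin 3) K :=
  X 0 ^ i * X 1 ^ j * X 2 ^ k * pf K n ^ p * pg K n ^ q * ph K n ^ r

section FourPoints

variable {K : Type*} [Field K]

theorem isHomogeneous_of_mul_left {σ : Type*} {u p : MvPolynomial σ K} {e d : ℕ} (hu : u ≠ 0)
    (hue : u.IsHomogeneous e) (h : (u * p).IsHomogeneous (e + d)) : p.IsHomogeneous d := by
  have key : u * p = u * homogeneousComponent d p := by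
    conv_lhs => rw [← homogeneousComponent_eq_self h, ← sum_homogeneousComponent p]
    rw [Finset.mul_sum, map_sum]
    have (i : ℕ) : homogeneousComponent (e + d) (u * homogeneousComponent i p) =
        if i = d then u * homogeneousComponent d p else 0 := by
      rw [homogeneousComponent_of_mem (hue.mul (homogeneousComponent_isHomogeneous i p))]
      by_cases hi : i = d
      · simp [hi]
      · simp [hi, Ne.symm hi]
    simp only [this, Finset.sum_ite_eq', Finset.mem_range]
    split_ifs with hd
    · rfl
    · rw [homogeneousComponent_eq_zero d p (by omega), mul_zero]
  rw [mul_left_cancel₀ hu key]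
  exact homogeneousComponent_isHomogeneous d p

theorem X_sub_X_ne_zero {σ : Type*} {i j : σ} (hij : i ≠ j) :
    (X i - X j : MvPolynomial σ K) ≠ 0 :=
  sub_ne_zero.2 fun h => hij (X_injective h)

theorem degreeOf_X_sub_X {σ : Type*} [DecidableEq σ] {i j : σ} (hij : i ≠ j) (k : σ) :
    degreeOf k (X i - X j : MvPolynomial σ K) = if k = i ∨ k = j then 1 else 0 := by
  refine le_antisymm ((degreeOf_sub_le _ _ _).trans ?_) ?_
  · simp only [degreeOf_X]
    split_ifs <;> simp_all
  · split_ifs with h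
    · rcases h with rfl | rfl
      · simpa using monomial_le_degreeOf (f := (X k - X j : MvPolynomial σ K)) k
          (m := Finsupp.single k 1) (by simp [coeff_X, Finsupp.single_left_inj, hij.symm])
      · simpa using monomial_le_degreeOf (f := (X i - X k : MvPolynomial σ K)) k
          (m := Finsupp.single k 1) (by simp [coeff_X, Finsupp.single_left_inj, hij])
    · exact Nat.zero_le _

variable (K) in
/-- The substitution `x ↦ z + tx`, `y ↦ z + ty`, `z ↦ z`: the order of vanishing at `(1 : 1 : 1)`
is the order in `t` of the result. -/
def unitPointSubst : MvPolynomial (Fin 3) K →ₐ[K] Polynomial (MvPolynomial (Fin 3) K) :=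
  aeval ![Polynomial.C (X 2) + Polynomial.X * Polynomial.C (X 0),
    Polynomial.C (X 2) + Polynomial.X * Polynomial.C (X 1), Polynomial.C (X 2)]

theorem X_pow_dvd_unitPointSubst {m : ℕ} {p : MvPolynomial (Fin 3) K} (hp : p ∈ Ifg K 1 ^ m) :
    Polynomial.X ^ m ∣ unitPointSubst K p := by
  have h1 : Ideal.map (unitPointSubst K) (Ifg K 1) ≤ Ideal.span {Polynomial.X} := by
    rw [Ifg, Ideal.map_span, Ideal.span_le]
    rintro _ ⟨q, rfl | rfl, rfl⟩
    · refine Ideal.mem_span_singleton.2 ⟨Polynomial.C (X 1), ?_⟩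
      simp [unitPointSubst, pf]
    · refine Ideal.mem_span_singleton.2 ⟨Polynomial.C (-X 0), ?_⟩
      simp only [unitPointSubst, pg, pow_one, map_sub, aeval_X, Matrix.cons_val, map_neg]
      ring
  have h2 := Ideal.pow_right_mono h1 m (Ideal.map_pow (unitPointSubst K) (Ifg K 1) m ▸
    Ideal.mem_map_of_mem (unitPointSubst K) hp)
  rwa [Ideal.span_singleton_pow, Ideal.mem_span_singleton] at h2

theorem fermatMonomial_mem_Ifg_pow {n m i j k p q r : ℕ} (h : m ≤ p + q + r) :
    fermatMonomial K n i j k p q r ∈ Ifg K n ^ m := by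
  have hf : pf K n ∈ Ifg K n := Ideal.subset_span (by simp)
  have hg : pg K n ∈ Ifg K n := Ideal.subset_span (by simp)
  have hh : ph K n ∈ Ifg K n := by
    convert (Ifg K n).neg_mem ((Ifg K n).add_mem hf hg) using 1
    simp only [pf, pg, ph]
    ring
  have := Ideal.mul_mem_mul (Ideal.mul_mem_mul (Ideal.pow_mem_pow hf p) (Ideal.pow_mem_pow hg q))
    (Ideal.pow_mem_pow hh r)
  rw [← pow_add, ← pow_add] at this
  convert Ideal.mul_mem_left _ (X 0 ^ i * X 1 ^ j * X 2 ^ k) (Ideal.pow_le_pow_right h this) using 1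
  simp only [fermatMonomial]
  ring

theorem exists_unitPointSubst_section :
    ∃ φ : Polynomial (MvPolynomial (Fin 3) K) →+* MvPolynomial (Fin 3) K,
      φ Polynomial.X = X 0 - X 2 ∧ ∀ p, φ (unitPointSubst K p) = aeval ![X 0, X 2, X 2] p := by
  let φ := Polynomial.eval₂RingHom
    (aeval ![1, 0, X 2] : MvPolynomial (Fin 3) K →ₐ[K] MvPolynomial (Fin 3) K).toRingHom
    (X 0 - X 2)
  have h : φ.comp (unitPointSubst K).toRingHom =
      (aeval ![X 0, X 2, X 2] : MvPolynomial (Fin 3) K →ₐ[K] MvPolynomial (Fin 3) K).toRingHom := by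
    refine MvPolynomial.ringHom_ext (fun c => ?_) fun i => ?_
    · simp [φ, unitPointSubst, algebraMap_eq,
        IsScalarTower.algebraMap_apply K (MvPolynomial (Fin 3) K)
          (Polynomial (MvPolynomial (Fin 3) K))]
    · fin_cases i <;> simp [φ, unitPointSubst]
  exact ⟨φ, by simp [φ], RingHom.congr_fun h⟩

theorem pf_dvd_of_degreeOf_lt {m : ℕ} {p : MvPolynomial (Fin 3) K}
    (hp : Polynomial.X ^ m ∣ unitPointSubst K p) (hd : p.degreeOf 0 < m) : pf K 1 ∣ p := by
  have hr : aeval ![X 0, X 2, X 2] p = (0 : MvPolynomial (Fin 3) K) := by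
    obtain ⟨φ, hφX, hφ⟩ := exists_unitPointSubst_section (K := K)
    obtain ⟨v, hv⟩ := hp
    have h1 := congrArg φ hv
    rw [hφ, map_mul, map_pow, hφX] at h1
    generalize φ v = v at h1
    by_contra hne
    have hX : (X 0 - X 2 : MvPolynomial (Fin 3) K) ≠ 0 := X_sub_X_ne_zero (by decide)
    have hv : v ≠ 0 := by
      rintro hv
      rw [hv, mul_zero] at h1
      exact hne h1
    have hle : degreeOf 0 (aeval ![X 0, X 2, X 2] p : MvPolynomial (Fin 3) K) ≤ degreeOf 0 p := by
      rw [aeval_def, eval₂_eq']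
      refine (degreeOf_sum_le _ _ _).trans (Finset.sup_le fun e he => ?_)
      refine le_trans ?_ (monomial_le_degreeOf 0 he)
      rw [algebraMap_eq]
      refine (degreeOf_C_mul_le _ _ _).trans ?_
      simp only [Fin.prod_univ_three, Matrix.cons_val]
      refine (degreeOf_mul_le _ _ _).trans ?_
      refine (add_le_add_left (degreeOf_mul_le _ _ _) _).trans ?_
      rw [degreeOf_pow_eq _ _ _ (X_ne_zero _), degreeOf_pow_eq _ _ _ (X_ne_zero _),
        degreeOf_pow_eq _ _ _ (X_ne_zero _)]
      simp [degreeOf_X]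
    rw [h1] at hle
    rw [degreeOf_mul_eq (pow_ne_zero _ hX) hv, degreeOf_pow_eq _ _ _ hX,
      degreeOf_X_sub_X (by decide)] at hle
    simp only [true_or, if_true] at hle
    omega
  rw [← Ideal.mem_span_singleton, ← Ideal.Quotient.eq_zero_iff_mem]
  have h4 : Ideal.Quotient.mk (Ideal.span {pf K 1}) =
      (Ideal.Quotient.mk (Ideal.span {pf K 1})).comp
        (aeval ![X 0, X 2, X 2] : MvPolynomial (Fin 3) K →ₐ[K] MvPolynomial (Fin 3) K).toRingHom := by
    refine MvPolynomial.ringHom_ext (fun c => by simp [algebraMap_eq]) fun i => ?_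
    fin_cases i
    · simp
    · simpa using Ideal.Quotient.eq.2 (Ideal.mem_span_singleton.2 (by simp [pf]))
    · simp
  rw [h4, RingHom.comp_apply, AlgHom.toRingHom_eq_coe, RingHom.coe_coe, hr, map_zero]

theorem isHomogeneous_fermatMonomial_one (i j k p q r : ℕ) :
    (fermatMonomial K 1 i j k p q r).IsHomogeneous (i + j + k + p + q + r) := by
  simp only [fermatMonomial, pf, pg, ph, pow_one]
  have hs (a b : Fin 3) (e : ℕ) : ((X a - X b : MvPolynomial (Fin 3) K) ^ e).IsHomogeneous e := by
    simpa using ((isHomogeneous_X K a).sub (isHomogeneous_X K b)).pow e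
  exact ((((((isHomogeneous_X_pow _ _).mul (isHomogeneous_X_pow _ _)).mul
    (isHomogeneous_X_pow _ _)).mul (hs _ _ _)).mul (hs _ _ _)).mul (hs _ _ _))

theorem degreeOf_fermatMonomial_one (i j k p q r : ℕ) (l : Fin 3) :
    degreeOf l (fermatMonomial K 1 i j k p q r) = ![i + q + r, j + r + p, k + p + q] l := by
  have h01 := X_sub_X_ne_zero (K := K) (i := (0 : Fin 3)) (j := 1) (by decide)
  have h12 := X_sub_X_ne_zero (K := K) (i := (1 : Fin 3)) (j := 2) (by decide)
  have h20 := X_sub_X_ne_zero (K := K) (i := (2 : Fin 3)) (j := 0) (by decide)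
  have hX (a : Fin 3) : (X a : MvPolynomial (Fin 3) K) ≠ 0 := X_ne_zero a
  simp only [fermatMonomial, pf, pg, ph, pow_one]
  rw [degreeOf_mul_eq (by simp [*]) (by simp [*]), degreeOf_mul_eq (by simp [*]) (by simp [*]),
    degreeOf_mul_eq (by simp [*]) (by simp [*]), degreeOf_mul_eq (by simp [*]) (by simp [*]),
    degreeOf_mul_eq (by simp [*]) (by simp [*])]
  rw [degreeOf_pow_eq _ _ _ (hX _), degreeOf_pow_eq _ _ _ (hX _), degreeOf_pow_eq _ _ _ (hX _),
    degreeOf_pow_eq _ _ _ h12, degreeOf_pow_eq _ _ _ h20, degreeOf_pow_eq _ _ _ h01,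
    degreeOf_X_sub_X (by decide), degreeOf_X_sub_X (by decide), degreeOf_X_sub_X (by decide)]
  simp only [degreeOf_X]
  fin_cases l <;> simp <;> ring

variable (K) in
/-- The forms of degree `d` vanishing to order at least `m` at `(1 : 1 : 1)`, whose degrees in the
three variables (equivalently, whose orders at the coordinate points) are bounded. -/
def fourPointForms (d m A B C : ℕ) : Submodule K (MvPolynomial (Fin 3) K) where
  carrier := {p | p.IsHomogeneous d ∧ Polynomial.X ^ m ∣ unitPointSubst K p ∧
    p.degreeOf 0 ≤ A ∧ p.degreeOf 1 ≤ B ∧ p.degreeOf 2 ≤ C}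
  zero_mem' := ⟨isHomogeneous_zero _ _ _, by simp, by simp, by simp, by simp⟩
  add_mem' := fun {p q} hp hq => ⟨hp.1.add hq.1, by rw [map_add]; exact dvd_add hp.2.1 hq.2.1,
    (degreeOf_add_le _ _ _).trans (max_le hp.2.2.1 hq.2.2.1),
    (degreeOf_add_le _ _ _).trans (max_le hp.2.2.2.1 hq.2.2.2.1),
    (degreeOf_add_le _ _ _).trans (max_le hp.2.2.2.2 hq.2.2.2.2)⟩
  smul_mem' := fun c p hp => by
    refine ⟨?_, ?_, ?_, ?_, ?_⟩
    · rw [smul_eq_C_mul]; exact hp.1.C_mul c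
    · rw [map_smul, Algebra.smul_def]; exact hp.2.1.mul_left _
    all_goals rw [smul_eq_C_mul]; refine (degreeOf_C_mul_le _ _ _).trans ?_
    exacts [hp.2.2.1, hp.2.2.2.1, hp.2.2.2.2]

variable (K) in
/-- The products of the six lines through pairs of the four points that lie in
`fourPointForms K d m A B C`. -/
def fourPointProducts (d m A B C : ℕ) : Set (MvPolynomial (Fin 3) K) :=
  {v | ∃ i j k p q r, v = fermatMonomial K 1 i j k p q r ∧ m ≤ p + q + r ∧ i + q + r ≤ A ∧
    j + r + p ≤ B ∧ k + p + q ≤ C ∧ i + j + k + p + q + r = d}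

theorem span_fourPointProducts_le (d m A B C : ℕ) :
    Submodule.span K (fourPointProducts K d m A B C) ≤ fourPointForms K d m A B C := by
  rw [Submodule.span_le]
  rintro _ ⟨i, j, k, p, q, r, rfl, h₁, h₂, h₃, h₄, rfl⟩
  refine ⟨isHomogeneous_fermatMonomial_one ..,
    X_pow_dvd_unitPointSubst (fermatMonomial_mem_Ifg_pow h₁), ?_, ?_, ?_⟩ <;>
  rw [degreeOf_fermatMonomial_one] <;> simpa

/-- Modulo `x`, a monomial is a combination of products of lines with the same bounds. -/
theorem exists_X_dvd_monomial_sub {d m A B C : ℕ} (hmA : m ≤ A) (hmd : m ≤ d) (e : Fin 3 →₀ ℕ)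
    (c : K) (he : e 0 + e 1 + e 2 = d) (hB : e 1 ≤ B) (hC : e 2 ≤ C) :
    ∃ w ∈ Submodule.span K (fourPointProducts K d m A B C), X 0 ∣ monomial e c - w := by
  have hmon : monomial e c = MvPolynomial.C c * (X 0 ^ e 0 * X 1 ^ e 1 * X 2 ^ e 2) := by
    rw [monomial_eq, Finsupp.prod_fintype _ _ (by simp), Fin.prod_univ_three]
  by_cases h0 : e 0 = 0
  · obtain ⟨q, r, hqr, hq, hr⟩ : ∃ q r, q + r = m ∧ q ≤ e 2 ∧ r ≤ e 1 :=
      ⟨min m (e 2), m - min m (e 2), by omega, by omega, by omega⟩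
    obtain ⟨k, hk⟩ := Nat.exists_eq_add_of_le hq
    obtain ⟨j, hj⟩ := Nat.exists_eq_add_of_le hr
    refine ⟨(c * (-1) ^ r) • fermatMonomial K 1 0 j k 0 q r, Submodule.smul_mem _ _
      (Submodule.subset_span ⟨0, j, k, 0, q, r, rfl, by omega, by omega, by omega, by omega,
        by omega⟩), ?_⟩
    obtain ⟨u, hu⟩ : (X 0 : MvPolynomial (Fin 3) K) ∣ (X 2 - X 0) ^ q - X 2 ^ q :=
      dvd_trans ⟨-1, by ring⟩ (sub_dvd_pow_sub_pow (X 2 - X 0) (X 2) q)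
    obtain ⟨v, hv⟩ : (X 0 : MvPolynomial (Fin 3) K) ∣ (X 0 - X 1) ^ r - (-X 1) ^ r :=
      dvd_trans ⟨1, by ring⟩ (sub_dvd_pow_sub_pow (X 0 - X 1) (-X 1) r)
    rw [sub_eq_iff_eq_add] at hu hv
    have hs : (-1 : MvPolynomial (Fin 3) K) ^ r * (-1) ^ r = 1 := by
      rw [← mul_pow]; simp
    rw [hmon, h0, hk, hj, smul_eq_C_mul]
    simp only [fermatMonomial, pf, pg, ph, pow_one, map_mul, map_pow, map_neg, map_one, hu, hv]
    refine ⟨-(MvPolynomial.C c * (-1) ^ r * X 1 ^ j * X 2 ^ k * 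
      (X 2 ^ q * v + u * (-X 1) ^ r + X 0 * u * v)), ?_⟩
    rw [neg_pow (X 1 : MvPolynomial (Fin 3) K)]
    linear_combination -(MvPolynomial.C c * X 1 ^ (r + j) * X 2 ^ (q + k)) * hs
  · refine ⟨0, Submodule.zero_mem _, ?_⟩
    obtain ⟨a, ha⟩ := Nat.exists_eq_add_one_of_ne_zero h0
    refine ⟨MvPolynomial.C c * (X 0 ^ a * X 1 ^ e 1 * X 2 ^ e 2), ?_⟩
    rw [hmon, ha]
    ring

theorem X_pow_dvd_of_dvd_X_mul {m : ℕ} {p : MvPolynomial (Fin 3) K}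
    (h : Polynomial.X ^ m ∣ unitPointSubst K (X 0 * p)) :
    Polynomial.X ^ m ∣ unitPointSubst K p := by
  rw [map_mul] at h
  refine Polynomial.prime_X.pow_dvd_of_dvd_mul_left m ?_ h
  simp [unitPointSubst, Polynomial.X_dvd_iff]

theorem X_pow_dvd_of_dvd_pf_mul {m : ℕ} {p : MvPolynomial (Fin 3) K}
    (h : Polynomial.X ^ (m + 1) ∣ unitPointSubst K (pf K 1 * p)) :
    Polynomial.X ^ m ∣ unitPointSubst K p := by
  have hf : unitPointSubst K (pf K 1) = Polynomial.X * Polynomial.C (X 1) := by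
    simp [unitPointSubst, pf]
  rw [map_mul, hf, pow_succ', mul_assoc, mul_dvd_mul_iff_left Polynomial.X_ne_zero] at h
  refine Polynomial.prime_X.pow_dvd_of_dvd_mul_left m ?_ h
  simp [Polynomial.X_dvd_iff]

theorem X_mul_mem_span_fourPointProducts {d m A B C : ℕ} {p : MvPolynomial (Fin 3) K}
    (hp : p ∈ Submodule.span K (fourPointProducts K d m A B C)) :
    X 0 * p ∈ Submodule.span K (fourPointProducts K (d + 1) m (A + 1) B C) := by
  induction hp using Submodule.span_induction with
  | mem v hv =>
    obtain ⟨i, j, k, p, q, r, rfl, h₁, h₂, h₃, h₄, rfl⟩ := hv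
    refine Submodule.subset_span ⟨i + 1, j, k, p, q, r, ?_, h₁, by omega, h₃, h₄, by omega⟩
    simp only [fermatMonomial]
    ring
  | zero => simp
  | add a b _ _ ha hb => rw [mul_add]; exact add_mem ha hb
  | smul c a _ ha => rw [mul_smul_comm]; exact Submodule.smul_mem _ _ ha

theorem pf_mul_mem_span_fourPointProducts {d m A B C : ℕ} {p : MvPolynomial (Fin 3) K}
    (hp : p ∈ Submodule.span K (fourPointProducts K d m A B C)) :
    pf K 1 * p ∈ Submodule.span K (fourPointProducts K (d + 1) (m + 1) A (B + 1) (C + 1)) := by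
  induction hp using Submodule.span_induction with
  | mem v hv =>
    obtain ⟨i, j, k, p, q, r, rfl, h₁, h₂, h₃, h₄, rfl⟩ := hv
    refine Submodule.subset_span
      ⟨i, j, k, p + 1, q, r, ?_, by omega, by omega, by omega, by omega, by omega⟩
    simp only [fermatMonomial]
    ring
  | zero => simp
  | add a b _ _ ha hb => rw [mul_add]; exact add_mem ha hb
  | smul c a _ ha => rw [mul_smul_comm]; exact Submodule.smul_mem _ _ ha

/-- Forms with prescribed multiplicities at four points of the plane in general position are
spanned by products of the six lines through pairs of these points. -/
theorem fourPointForms_le_span (d m A B C : ℕ) :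
    fourPointForms K d m A B C ≤ Submodule.span K (fourPointProducts K d m A B C) := by
  induction d generalizing m A B C with
  | zero =>
    rintro p ⟨h, hm, -⟩
    rw [← totalDegree_zero_iff_isHomogeneous, totalDegree_eq_zero_iff_eq_C] at h
    generalize coeff 0 p = c at h
    subst h
    by_cases hc : c = 0
    · simp [hc]
    have hm0 : m = 0 := by
      by_contra hne
      have := (dvd_pow_self _ hne).trans hm
      rw [Polynomial.X_dvd_iff] at this
      simp [unitPointSubst, algebraMap_eq,
          IsScalarTower.algebraMap_apply K (MvPolynomial (Fin 3) K)
            (Polynomial (MvPolynomial (Fin 3) K)), hc] at this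
    subst hm0
    have := Submodule.smul_mem (Submodule.span K (fourPointProducts K 0 0 A B C)) c
      (Submodule.subset_span ⟨0, 0, 0, 0, 0, 0, rfl, by omega, by omega, by omega, by omega, rfl⟩)
    simpa [fermatMonomial, smul_eq_C_mul] using this
  | succ d ih =>
    intro p hp
    by_cases hmA : m ≤ A ∧ m ≤ d + 1
    · have hex : ∀ e ∈ p.support, ∃ w ∈ Submodule.span K (fourPointProducts K (d + 1) m A B C),
          X 0 ∣ monomial e (coeff e p) - w := by
        intro e he
        refine exists_X_dvd_monomial_sub hmA.1 hmA.2 e _ ?_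
          ((monomial_le_degreeOf 1 he).trans hp.2.2.2.1)
          ((monomial_le_degreeOf 2 he).trans hp.2.2.2.2)
        have := hp.1.degree_eq_sum_deg_support he
        rw [this, ← Finsupp.degree_apply, Finsupp.degree_eq_sum, Fin.sum_univ_three]
      choose! w hw hdvd using hex
      have hsum : ∑ e ∈ p.support, w e ∈
          Submodule.span K (fourPointProducts K (d + 1) m A B C) := Submodule.sum_mem _ hw
      obtain ⟨p', hp'⟩ : X 0 ∣ p - ∑ e ∈ p.support, w e := by
        conv => enter [2, 1]; rw [p.as_sum]
        rw [← Finset.sum_sub_distrib]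
        exact Finset.dvd_sum hdvd
      have hV := sub_mem hp (span_fourPointProducts_le _ _ _ _ _ hsum)
      rw [hp'] at hV
      rw [← sub_add_cancel p (∑ e ∈ p.support, w e), hp']
      refine add_mem ?_ hsum
      by_cases h0 : p' = 0
      · simp [h0]
      obtain ⟨v₁, v₂, v₃, v₄, v₅⟩ := hV
      rw [degreeOf_mul_eq (X_ne_zero _) h0, degreeOf_X] at v₃ v₄ v₅
      simp at v₃ v₄ v₅
      obtain ⟨A, rfl⟩ : ∃ A', A = A' + 1 := ⟨A - 1, by omega⟩
      refine X_mul_mem_span_fourPointProducts (ih _ _ _ _ ⟨?_, X_pow_dvd_of_dvd_X_mul v₂,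
        by omega, v₄, v₅⟩)
      rw [add_comm] at v₁
      exact isHomogeneous_of_mul_left (X_ne_zero _) (isHomogeneous_X _ _) v₁
    · have hlt : p.degreeOf 0 < m := by
        have h1 := hp.2.2.1
        have h2 := (degreeOf_le_totalDegree p 0).trans hp.1.totalDegree_le
        omega
      obtain ⟨m, rfl⟩ : ∃ m', m = m' + 1 := ⟨m - 1, by omega⟩
      obtain ⟨p', rfl⟩ := pf_dvd_of_degreeOf_lt hp.2.1 hlt
      by_cases h0 : p' = 0
      · simp [h0]
      have hf : pf K 1 ≠ 0 := by
        simpa [pf] using X_sub_X_ne_zero (K := K) (i := (1 : Fin 3)) (j := 2) (by decide)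
      have hfh : (pf K 1).IsHomogeneous 1 := by
        simpa [pf] using (isHomogeneous_X K (1 : Fin 3)).sub (isHomogeneous_X K (2 : Fin 3))
      have hfd (l : Fin 3) : degreeOf l (pf K 1) = if l = 1 ∨ l = 2 then 1 else 0 := by
        simpa [pf] using degreeOf_X_sub_X (K := K) (i := (1 : Fin 3)) (j := 2) (by decide) l
      obtain ⟨v₁, v₂, v₃, v₄, v₅⟩ := hp
      rw [degreeOf_mul_eq hf h0, hfd] at v₃ v₄ v₅
      simp at v₃ v₄ v₅
      obtain ⟨B, rfl⟩ : ∃ B', B = B' + 1 := ⟨B - 1, by omega⟩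
      obtain ⟨C, rfl⟩ : ∃ C', C = C' + 1 := ⟨C - 1, by omega⟩
      refine pf_mul_mem_span_fourPointProducts (ih _ _ _ _ ⟨?_, X_pow_dvd_of_dvd_pf_mul v₂,
        v₃, by omega, by omega⟩)
      rw [add_comm] at v₁
      exact isHomogeneous_of_mul_left hf hfh v₁

end FourPoints

section SymbolicPower

variable {K : Type*} [Field K] {n : ℕ}

/-- The ideal of polynomials all of whose monomials have degree at least `m` in the variables
`a` and `b`. -/
def pairDegreeIdeal (K : Type*) [Field K] (a b : Fin 3) (m : ℕ) : Ideal (MvPolynomial (Fin 3) K) where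
  carrier := {p | ∀ e ∈ p.support, m ≤ e a + e b}
  zero_mem' := by simp
  add_mem' := fun {p q} hp hq e he => by
    classical
    rcases Finset.mem_union.1 (support_add he) with h | h
    exacts [hp e h, hq e h]
  smul_mem' := fun c p hp e he => by
    classical
    obtain ⟨u, -, v, hv, rfl⟩ := Finset.mem_add.1 (support_mul c p he)
    have := hp v hv
    simp only [Finsupp.add_apply]
    omega

theorem span_X_pow_le_pairDegreeIdeal (a b : Fin 3) (m : ℕ) :
    (Ideal.span {X a, X b} : Ideal (MvPolynomial (Fin 3) K)) ^ m ≤ pairDegreeIdeal K a b m := by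
  induction m with
  | zero => exact fun p _ e _ => Nat.zero_le _
  | succ m ih =>
    rw [pow_succ, Ideal.mul_le]
    intro p hp q hq e he
    classical
    obtain ⟨u, hu, v, hv, rfl⟩ := Finset.mem_add.1 (support_mul p q he)
    have h1 : (Ideal.span {X a, X b} : Ideal (MvPolynomial (Fin 3) K)) ≤
        pairDegreeIdeal K a b 1 := by
      rw [Ideal.span_le]
      rintro _ (rfl | rfl) e he <;>
      · rw [support_X, Finset.mem_singleton] at he
        subst he
        simp
    have h2 := ih hp u hu
    have h3 := h1 hq v hv
    simp only [Finsupp.add_apply]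
    omega

/-- The polynomial `q` such that the part of `p` in degrees congruent to `ρ` modulo `n` is
`x^ρ q(xⁿ, yⁿ, zⁿ)`. -/
def residueComponent (K : Type*) [Field K] (n : ℕ) (ρ : Fin 3 → Fin n) :
    MvPolynomial (Fin 3) K →ₗ[K] MvPolynomial (Fin 3) K :=
  (basisMonomials (Fin 3) K).constr K fun e =>
    if ∀ i, e i % n = ρ i then monomial (e.mapRange (· / n) (Nat.zero_div n)) 1 else 0

theorem residueComponent_monomial (ρ : Fin 3 → Fin n) (e : Fin 3 →₀ ℕ) :
    residueComponent K n ρ (monomial e 1) =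
      if ∀ i, e i % n = ρ i then monomial (e.mapRange (· / n) (Nat.zero_div n)) 1 else 0 := by
  have := (basisMonomials (Fin 3) K).constr_basis K (fun e =>
    if ∀ i, e i % n = ρ i then (monomial (e.mapRange (· / n) (Nat.zero_div n)) 1 :
      MvPolynomial (Fin 3) K) else 0) e
  rwa [coe_basisMonomials] at this

theorem exists_of_mem_support_residueComponent {ρ : Fin 3 → Fin n} {p : MvPolynomial (Fin 3) K}
    {e : Fin 3 →₀ ℕ} (he : e ∈ (residueComponent K n ρ p).support) :
    ∃ δ ∈ p.support, ∀ i, δ i = ρ i + n * e i := by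
  rw [mem_support_iff, p.as_sum, map_sum, coeff_sum] at he
  obtain ⟨δ, hδ, h⟩ := Finset.exists_ne_zero_of_sum_ne_zero he
  refine ⟨δ, hδ, fun i => ?_⟩
  rw [← mul_one (coeff δ p), ← smul_eq_mul, ← smul_monomial, map_smul,
    residueComponent_monomial] at h
  split_ifs at h with hρ
  · have : δ.mapRange (· / n) (Nat.zero_div n) = e := by
      by_contra hne
      simp [coeff_monomial, hne] at h
    rw [← this, Finsupp.mapRange_apply, ← hρ i, Nat.mod_add_div]
  · simp at h

theorem residueComponent_X_pow_mul (hn : 0 < n) (ρ : Fin 3 → Fin n) (i : Fin 3)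
    (p : MvPolynomial (Fin 3) K) :
    residueComponent K n ρ (X i ^ n * p) = X i * residueComponent K n ρ p := by
  induction p using MvPolynomial.induction_on' with
  | monomial e a =>
    have h1 : (∀ l, (Finsupp.single i n + e : Fin 3 →₀ ℕ) l % n = ρ l) ↔ ∀ l, e l % n = ρ l := by
      refine forall_congr' fun l => ?_
      rw [Finsupp.add_apply, Finsupp.single_apply]
      split_ifs <;> simp
    have h2 : (Finsupp.single i n + e).mapRange (· / n) (Nat.zero_div n) =
        Finsupp.single i 1 + e.mapRange (· / n) (Nat.zero_div n) := by
      ext l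
      simp only [Finsupp.mapRange_apply, Finsupp.add_apply, Finsupp.single_apply]
      split_ifs
      · rw [Nat.add_div_left _ hn, add_comm]
      · simp
    have h3 : monomial e a = a • (monomial e 1 : MvPolynomial (Fin 3) K) := by
      rw [smul_monomial, smul_eq_mul, mul_one]
    rw [h3, mul_smul_comm, map_smul, map_smul, mul_smul_comm, X_pow_eq_monomial, monomial_mul,
      one_mul, residueComponent_monomial, residueComponent_monomial, if_congr h1 rfl rfl, h2, mul_ite, mul_zero, X, monomial_mul,
      one_mul]
  | add p q hp hq => rw [mul_add, map_add, hp, hq, map_add, mul_add]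

theorem residueComponent_expand_mul (hn : 0 < n) (ρ : Fin 3 → Fin n)
    (u p : MvPolynomial (Fin 3) K) :
    residueComponent K n ρ (expand n u * p) = u * residueComponent K n ρ p := by
  induction u using MvPolynomial.induction_on generalizing p with
  | C a => rw [expand_C, ← smul_eq_C_mul, map_smul, smul_eq_C_mul]
  | add u v hu hv => rw [map_add, add_mul, map_add, hu, hv, add_mul]
  | mul_X u i hu =>
    rw [map_mul (expand n), expand_X, mul_assoc, hu, residueComponent_X_pow_mul hn, mul_assoc]

theorem sum_residueComponent (hn : 0 < n) (p : MvPolynomial (Fin 3) K) :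
    ∑ ρ : Fin 3 → Fin n, X 0 ^ (ρ 0 : ℕ) * X 1 ^ (ρ 1 : ℕ) * X 2 ^ (ρ 2 : ℕ) *
      expand n (residueComponent K n ρ p) = p := by
  induction p using MvPolynomial.induction_on' with
  | monomial e a =>
    rw [← mul_one a, ← smul_eq_mul, ← smul_monomial]
    simp only [map_smul, mul_smul_comm, ← Finset.smul_sum]
    congr 1
    have hexp (i : Fin 3) : (X i : MvPolynomial (Fin 3) K) ^ (e i % n) * (X i ^ n) ^ (e i / n) =
        X i ^ e i := by
      rw [← pow_mul, ← pow_add, Nat.mod_add_div]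
    have hmon (d : Fin 3 →₀ ℕ) : (monomial d 1 : MvPolynomial (Fin 3) K) =
        X 0 ^ d 0 * X 1 ^ d 1 * X 2 ^ d 2 := by
      rw [monomial_eq, C_1, one_mul, Finsupp.prod_fintype _ _ (by simp), Fin.prod_univ_three]
    rw [Finset.sum_eq_single (fun i => ⟨e i % n, Nat.mod_lt _ hn⟩)]
    · rw [residueComponent_monomial, if_pos fun i => rfl, hmon, hmon e, ← hexp 0, ← hexp 1,
        ← hexp 2]
      simp only [map_mul, map_pow, expand_X, Finsupp.mapRange_apply]
      ring
    · intro ρ _ hρ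
      rw [residueComponent_monomial, if_neg, map_zero, mul_zero]
      exact fun h => hρ (funext fun i => Fin.ext (h i).symm)
    · simp
  | add p q hp hq =>
    simp only [map_add, mul_add, Finset.sum_add_distrib, hp, hq]

theorem residueComponent_mem_Ifg_pow (hn : 0 < n) (ρ : Fin 3 → Fin n) {m : ℕ}
    {p : MvPolynomial (Fin 3) K} (hp : p ∈ Ifg K n ^ m) :
    residueComponent K n ρ p ∈ Ifg K 1 ^ m := by
  have h : Ifg K n = (Ifg K 1).map (expand n) := by
    simp [Ifg, Ideal.map_span, Set.image_pair, pf, pg]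
  rw [h, ← Ideal.map_pow, Ideal.map] at hp
  suffices h : ∀ w, residueComponent K n ρ (w * p) ∈ Ifg K 1 ^ m by simpa using h 1
  induction hp using Submodule.span_induction with
  | mem v hv =>
    obtain ⟨u, hu, rfl⟩ := hv
    intro w
    rw [mul_comm]
    exact residueComponent_expand_mul hn ρ u w ▸ Ideal.mul_mem_right _ _ hu
  | zero => simp
  | add a b _ _ ha hb => intro w; rw [mul_add, map_add]; exact add_mem (ha w) (hb w)
  | smul c a _ ha => intro w; rw [smul_eq_mul, ← mul_assoc]; exact ha (w * c)

attribute [local instance] MvPolynomial.gradedAlgebra in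
theorem homogeneousComponent_mem_Ifg_pow {m : ℕ} {p : MvPolynomial (Fin 3) K}
    (hp : p ∈ Ifg K 1 ^ m) (d : ℕ) : homogeneousComponent d p ∈ Ifg K 1 ^ m := by
  have h1 : (Ifg K 1).IsHomogeneous (homogeneousSubmodule (Fin 3) K) := by
    refine Ideal.homogeneous_span _ _ ?_
    rintro _ (rfl | rfl)
    · refine ⟨1, ?_⟩
      simpa [pf] using (isHomogeneous_X K (1 : Fin 3)).sub (isHomogeneous_X K (2 : Fin 3))
    · refine ⟨1, ?_⟩
      simpa [pg] using (isHomogeneous_X K (2 : Fin 3)).sub (isHomogeneous_X K (0 : Fin 3))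
  have h2 (k : ℕ) : (Ifg K 1 ^ k).IsHomogeneous (homogeneousSubmodule (Fin 3) K) := by
    induction k with
    | zero =>
      rw [pow_zero, Ideal.one_eq_top]
      exact Ideal.IsHomogeneous.top _
    | succ k ih => exact pow_succ (Ifg K 1) k ▸ ih.mul h1
  exact homogeneousComponent_mem_of_mem (h2 m) hp d

/-- Symbolic powers of the Fermat ideal are generated by products `xⁱyʲzᵏfᵖg^qhʳ`. -/
theorem symbPow_le (hn : 0 < n) {m : ℕ} {Q : Ideal (MvPolynomial (Fin 3) K)}
    (hQ : ∀ i j k p q r, FermatExps n m i j k p q r → fermatMonomial K n i j k p q r ∈ Q) :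
    symbPow K n m ≤ Q := by
  rintro P ⟨⟨⟨hfg, hxy⟩, hyz⟩, hzx⟩
  rw [← sum_residueComponent hn P]
  refine Ideal.sum_mem _ fun ρ _ => ?_
  rw [← sum_homogeneousComponent (residueComponent K n ρ P), map_sum, Finset.mul_sum]
  refine Ideal.sum_mem _ fun d _ => ?_
  have hmin (a : ℕ) : ∃ t, m ≤ a + n * t ∧ ∀ k, m ≤ a + n * k → t ≤ k := by
    classical
    have hex : ∃ t, m ≤ a + n * t := ⟨m, by nlinarith⟩
    exact ⟨Nat.find hex, Nat.find_spec hex, fun k hk => Nat.find_min' hex hk⟩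
  obtain ⟨s, hs, hs'⟩ := hmin (ρ 0 + ρ 1)
  obtain ⟨t, ht, ht'⟩ := hmin (ρ 1 + ρ 2)
  obtain ⟨u, hu, hu'⟩ := hmin (ρ 2 + ρ 0)
  have hsupp : ∀ e ∈ (homogeneousComponent d (residueComponent K n ρ P)).support,
      e 0 + e 1 + e 2 = d ∧ s ≤ e 0 + e 1 ∧ t ≤ e 1 + e 2 ∧ u ≤ e 2 + e 0 := by
    intro e he
    rw [support_homogeneousComponent, Finset.mem_filter] at he
    obtain ⟨δ, hδ, hδe⟩ := exists_of_mem_support_residueComponent he.1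
    refine ⟨?_, hs' _ ?_, ht' _ ?_, hu' _ ?_⟩
    · rw [← he.2, Finsupp.degree_eq_sum, Fin.sum_univ_three]
    · have := span_X_pow_le_pairDegreeIdeal 0 1 m hxy δ hδ
      rw [hδe, hδe] at this; linarith
    · have := span_X_pow_le_pairDegreeIdeal 1 2 m hyz δ hδ
      rw [hδe, hδe] at this; linarith
    · have := span_X_pow_le_pairDegreeIdeal 2 0 m hzx δ hδ
      rw [hδe, hδe] at this; linarith
  by_cases h0 : homogeneousComponent d (residueComponent K n ρ P) = 0
  · simp [h0]
  obtain ⟨e, he⟩ := support_nonempty.2 h0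
  obtain ⟨hd, hsd, htd, hud⟩ := hsupp e he
  have hmem := fourPointForms_le_span d m (d - t) (d - u) (d - s)
    ⟨homogeneousComponent_isHomogeneous d (residueComponent K n ρ P),
      X_pow_dvd_unitPointSubst (homogeneousComponent_mem_Ifg_pow
        (residueComponent_mem_Ifg_pow hn ρ hfg) d),
      degreeOf_le_iff.2 fun e he => by have := hsupp e he; omega,
      degreeOf_le_iff.2 fun e he => by have := hsupp e he; omega,
      degreeOf_le_iff.2 fun e he => by have := hsupp e he; omega⟩
  generalize homogeneousComponent d (residueComponent K n ρ P) = v at hmem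
  induction hmem using Submodule.span_induction with
  | mem v hv =>
    obtain ⟨i, j, k, p, q, r, rfl, h₁, h₂, h₃, h₄, h₅⟩ := hv
    have g₁ := Nat.mul_le_mul_left n (show s ≤ i + j + r by omega)
    have g₂ := Nat.mul_le_mul_left n (show t ≤ j + k + p by omega)
    have g₃ := Nat.mul_le_mul_left n (show u ≤ k + i + q by omega)
    convert hQ (ρ 0 + n * i) (ρ 1 + n * j) (ρ 2 + n * k) p q r
      ⟨h₁, by linarith, by linarith, by linarith⟩ using 1
    simp only [fermatMonomial, pf, pg, ph, map_mul, map_pow, map_sub, expand_X, pow_one]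
    ring
  | zero => simp
  | add a b _ _ ha hb => rw [map_add, mul_add]; exact add_mem ha hb
  | smul c a _ ha =>
    rw [map_smul, mul_smul_comm, smul_eq_C_mul]
    exact Ideal.mul_mem_left _ _ ha

theorem fermatMonomial_mem_symbPow {m i j k p q r : ℕ} (he : FermatExps n m i j k p q r) :
    fermatMonomial K n i j k p q r ∈ symbPow K n m := by
  have key (I : Ideal (MvPolynomial (Fin 3) K)) {a b u : MvPolynomial (Fin 3) K} (ha : a ∈ I)
      (hb : b ∈ I) (hu : u ∈ I ^ n) {s t l : ℕ} (hm : m ≤ s + t + n * l)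
      (w : MvPolynomial (Fin 3) K) : w * (a ^ s * b ^ t * u ^ l) ∈ I ^ m := by
    refine Ideal.mul_mem_left _ _ (Ideal.pow_le_pow_right hm ?_)
    rw [pow_add, pow_add, pow_mul]
    exact Ideal.mul_mem_mul (Ideal.mul_mem_mul (Ideal.pow_mem_pow ha s) (Ideal.pow_mem_pow hb t))
      (Ideal.pow_mem_pow hu l)
  have key' (a b : MvPolynomial (Fin 3) K) {s t l : ℕ} (hm : m ≤ s + t + n * l)
      (w : MvPolynomial (Fin 3) K) :
      w * (a ^ s * b ^ t * (a ^ n - b ^ n) ^ l) ∈ Ideal.span {a, b} ^ m :=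
    have ha : a ∈ Ideal.span {a, b} := Ideal.subset_span (by simp)
    have hb : b ∈ Ideal.span {a, b} := Ideal.subset_span (by simp)
    key _ ha hb (sub_mem (Ideal.pow_mem_pow ha n) (Ideal.pow_mem_pow hb n)) hm w
  refine ⟨⟨⟨fermatMonomial_mem_Ifg_pow he.1, ?_⟩, ?_⟩, ?_⟩
  · change _ ∈ Ixy K ^ m
    rw [Ixy]
    convert key' (X 0) (X 1) he.2.1 (X 2 ^ k * pf K n ^ p * pg K n ^ q) using 1
    simp only [fermatMonomial, ph]; ring
  · change _ ∈ Iyz K ^ m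
    rw [Iyz]
    convert key' (X 1) (X 2) he.2.2.1 (X 0 ^ i * pg K n ^ q * ph K n ^ r) using 1
    simp only [fermatMonomial, pf]; ring
  · change _ ∈ Izx K ^ m
    rw [Izx]
    convert key' (X 2) (X 0) he.2.2.2 (X 1 ^ j * pf K n ^ p * ph K n ^ r) using 1
    simp only [fermatMonomial, pg]; ring

theorem symbPow_sq_le (m : ℕ) : symbPow K n m ^ 2 ≤ symbPow K n (2 * m) := by
  have key {I A : Ideal (MvPolynomial (Fin 3) K)} (h : A ≤ I ^ m) : A ^ 2 ≤ I ^ (2 * m) := by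
    rw [mul_comm, pow_mul]; exact Ideal.pow_right_mono h 2
  refine le_inf (le_inf (le_inf ?_ ?_) ?_) ?_ <;> refine key fun p hp => ?_
  exacts [hp.1.1.1, hp.1.1.2, hp.1.2, hp.2]

end SymbolicPower

/-- for `n ≥ 3`, the ideal
`J = (f^{n−2}gh, fg^{n−2}h, g^{n−2}f²xⁿ + h^{n−2}g²yⁿ + f^{n−2}h²zⁿ)` satisfies
`J·I^{(n)} = I^{(2n)}`; since `I^{(2n)} = (I^{(n)})²`, `J ⊆ I^{(n)}` is a reduction of
`I^{(n)}` with reduction number one: `(I^{(n)})² = J·I^{(n)}`. -/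
theorem fermat_reduction_number_one {K : Type*} [Field K] (n : ℕ) (hn : 3 ≤ n)
    (hζ : ∃ ζ : K, IsPrimitiveRoot ζ n) (hinv : IsUnit (n : K))
    (J : Ideal (MvPolynomial (Fin 3) K))
    (hJ : J = Ideal.span {pf K n ^ (n - 2) * pg K n * ph K n,
      pf K n * pg K n ^ (n - 2) * ph K n,
      pg K n ^ (n - 2) * pf K n ^ 2 * X 0 ^ n + ph K n ^ (n - 2) * pg K n ^ 2 * X 1 ^ n +
        pf K n ^ (n - 2) * ph K n ^ 2 * X 2 ^ n}) :
    J ≤ symbPow K n n ∧ J * symbPow K n n = symbPow K n (2 * n) ∧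
      symbPow K n (2 * n) = (symbPow K n n) ^ 2 ∧
      (symbPow K n n) ^ 2 = J * symbPow K n n := by

  have hle : J ≤ symbPow K n n := by
    rw [hJ, Ideal.span_le]
    rintro _ (rfl | rfl | rfl)
    · rw [SetLike.mem_coe]
      convert fermatMonomial_mem_symbPow (K := K) (n := n) (m := n) (i := 0) (j := 0) (k := 0)
        (p := n - 2) (q := 1) (r := 1) ⟨by omega, by omega, ?_, by omega⟩ using 1
      · simp only [fermatMonomial]; ring
      · nlinarith [show 1 ≤ n - 2 by omega]
    · rw [SetLike.mem_coe]
      convert fermatMonomial_mem_symbPow (K := K) (n := n) (m := n) (i := 0) (j := 0) (k := 0)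
        (p := 1) (q := n - 2) (r := 1) ⟨by omega, by omega, by omega, ?_⟩ using 1
      · simp only [fermatMonomial]; ring
      · nlinarith [show 1 ≤ n - 2 by omega]
    · refine add_mem (add_mem ?_ ?_) ?_
      · convert fermatMonomial_mem_symbPow (K := K) (n := n) (m := n) (i := n) (j := 0) (k := 0)
          (p := 2) (q := n - 2) (r := 0) ⟨by omega, by omega, by omega, by omega⟩ using 1
        simp only [fermatMonomial]; ring
      · convert fermatMonomial_mem_symbPow (K := K) (n := n) (m := n) (i := 0) (j := n) (k := 0)
          (p := 0) (q := 2) (r := n - 2) ⟨by omega, by omega, by omega, by omega⟩ using 1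
        simp only [fermatMonomial]; ring
      · convert fermatMonomial_mem_symbPow (K := K) (n := n) (m := n) (i := 0) (j := 0) (k := n)
          (p := n - 2) (q := 0) (r := 2) ⟨by omega, by omega, by omega, by omega⟩ using 1
        simp only [fermatMonomial]; ring
  have hfgh : pf K n + pg K n + ph K n = 0 := by
    simp only [pf, pg, ph]; ring
  have hmem (u : MvPolynomial (Fin 3) K) (hu : u ∈ J) (i j k p q r : ℕ)
      (he : FermatExps n n i j k p q r) : u * (X 0 ^ i * X 1 ^ j * X 2 ^ k * pf K n ^ p *
        pg K n ^ q * ph K n ^ r) ∈ J * symbPow K n n :=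
    Ideal.mul_mem_mul hu (fermatMonomial_mem_symbPow he)
  have hge : symbPow K n (2 * n) ≤ J * symbPow K n n :=
    symbPow_le (by omega) (mem_of_fermatExps hn hfgh rfl
      (fun i j k p q r hp hq hr he => mem_of_exps_pos hn hfgh
        (hmem _ (hJ ▸ Ideal.subset_span (by simp))) (hmem _ (hJ ▸ Ideal.subset_span (by simp)))
        i j k r p q hp hq hr he)
      (hmem _ (hJ ▸ Ideal.subset_span (by simp))) rfl rfl)
  have h₁ : J * symbPow K n n ≤ symbPow K n n ^ 2 := by
    rw [sq]; exact Ideal.mul_mono_left hle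
  have h₂ := symbPow_sq_le (K := K) (n := n) n
  exact ⟨hle, le_antisymm (h₁.trans h₂) hge, le_antisymm (hge.trans h₁) h₂,
    le_antisymm (h₂.trans hge) h₁⟩
end
end
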